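/- Suppose n, d → ∞ in a regime where d²/(n log n) stays bounded above and below by positive constants (d² ≍ n log n). If n·P(F_1) → ∞ as n → ∞, then the events F_1 and F_2 are asymptotically independent in the sense that P(F_1 ∩ F_2) = P(F_1)·P(F_2)·(1 + ω_n) with ω_n → 0. -/

import Mathlib

open MeasureTheory ProbabilityTheory Filter Topology Matrix

noncomputable section

/-- The law `N(0, I_d/d)` on `ℝ^d`. -/
def stdGaussianVec (d : ℕ) : Measure (Fin d → ℝ) :=
  Measure.pi fun _ => gaussianReal 0 (d : NNReal)⁻¹

/-- The Gaussian model: `u_1, …, u_n, v_1, …, v_n` mutually independent `N(0, I_d/d)`. -/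
def gaussianModel (d n : ℕ) :
    Measure ((Fin n → Fin d → ℝ) × (Fin n → Fin d → ℝ)) :=
  (Measure.pi fun _ : Fin n => stdGaussianVec d).prod
    (Measure.pi fun _ : Fin n => stdGaussianVec d)

/-- The correlation matrix memory `W^× = U Vᵀ`. -/
def Wcross {d n : ℕ} (u v : Fin n → Fin d → ℝ) : Matrix (Fin d) (Fin d) ℝ :=
  Matrix.of fun a b => ∑ i, u i a * v i b

/-- The score `s_{j,i} = u_j^⊤ W^× v_i` under the correlation matrix memory. -/
def scoreX {d n : ℕ} (u v : Fin n → Fin d → ℝ) (j i : Fin n) : ℝ :=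
  u j ⬝ᵥ (Wcross u v).mulVec (v i)

/-- The retrieval failure event `F_{i₀}`, 0-based index `i₀ : ℕ`. -/
def failSet (d n : ℕ) (i₀ : ℕ) : Set ((Fin n → Fin d → ℝ) × (Fin n → Fin d → ℝ)) :=
  {p | ∃ i j : Fin n, (i : ℕ) = i₀ ∧ j ≠ i ∧ scoreX p.1 p.2 i i ≤ scoreX p.1 p.2 j i}

open scoped NNReal ENNReal

/-- iid centered Gaussian coordinates with variance s -/
noncomputable abbrev gam (s : ℝ≥0) (ι : Type*) [Fintype ι] : Measure (ι → ℝ) :=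
  Measure.pi fun _ => gaussianReal 0 s

lemma integral_exp_gam {ι : Type*} [Fintype ι] (s : ℝ≥0) (l : ι → ℝ) :
    ∫ x, Complex.exp (((∑ i, l i * x i : ℝ) : ℂ) * Complex.I) ∂(gam s ι)
      = Complex.exp (-(s * (∑ i, l i ^ 2 : ℝ) : ℝ) / 2) := by
  push_cast
  simp_rw [Finset.sum_mul, Complex.exp_sum]
  rw [integral_fintype_prod_eq_prod
    (f := fun i x ↦ Complex.exp (((l i : ℝ) : ℂ) * (x:ℝ) * Complex.I))]
  simp_rw [← charFun_apply_real, charFun_gaussianReal, ← Complex.exp_sum]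
  congr 1
  simp [Finset.mul_sum, Finset.sum_div, neg_div]

lemma cois {ι κ : Type*} [Fintype ι] [Fintype κ] (s : ℝ≥0)
    (f : (ι → ℝ) → (κ → ℝ)) (g : (κ → ℝ) → (ι → ℝ)) (hf : Measurable f)
    (hadj : ∀ x l, ∑ k, l k * f x k = ∑ i, g l i * x i)
    (hiso : ∀ l, ∑ i, g l i ^ 2 = ∑ k, l k ^ 2) :
    MeasurePreserving f (gam s ι) (gam s κ) := by
  classical
  refine ⟨hf, ?_⟩
  have : IsProbabilityMeasure (Measure.map f (gam s ι)) :=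
    Measure.isProbabilityMeasure_map hf.aemeasurable
  apply Measure.ext_of_charFunDual
  ext L
  have h : ∀ x : κ → ℝ, L x = ∑ i, L (Pi.single i 1) * x i := by
    intro x
    conv_lhs => rw [pi_eq_sum_univ' x]
    simp [mul_comm]
  rw [charFunDual_apply, charFunDual_apply, integral_map hf.aemeasurable (by fun_prop)]
  set l : κ → ℝ := fun i => L (Pi.single i 1)
  calc _ = ∫ x, Complex.exp (((∑ i, g l i * x i : ℝ) : ℂ) * Complex.I) ∂(gam s ι) := by
        congr 1; ext x; rw [h (f x), ← hadj]
    _ = ∫ x, Complex.exp (((∑ i, l i * x i : ℝ) : ℂ) * Complex.I) ∂(gam s κ) := by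
        rw [integral_exp_gam, integral_exp_gam, hiso]
    _ = _ := by congr 1; ext x; rw [h x]

lemma mp_curry {ι κ : Type*} [Fintype ι] [Fintype κ] (s : ℝ≥0) :
    MeasurePreserving (MeasurableEquiv.curry ι κ ℝ) (gam s (ι × κ))
      (Measure.pi fun _ : ι => gam s κ) := by
  refine ⟨(MeasurableEquiv.curry ι κ ℝ).measurable, ?_⟩
  have := Measure.infinitePi_map_curry (ι := ι) (κ := κ) (fun _ _ => gaussianReal 0 s)
  simpa [Measure.infinitePi_eq_pi] using this

/-- linear combination of rows -/
lemma mp_comb {ι κ : Type*} [Fintype ι] [Fintype κ] (s : ℝ≥0) (c : ι → ℝ) (hc : ∑ i, c i ^ 2 = 1) :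
    MeasurePreserving (fun (V : ι → κ → ℝ) k => ∑ i, c i * V i k)
      (Measure.pi fun _ : ι => gam s κ) (gam s κ) := by
  have h1 : MeasurePreserving (fun (x : ι × κ → ℝ) k => ∑ i, c i * x (i, k))
      (gam s (ι × κ)) (gam s κ) := by
    apply cois s _ (fun l p => c p.1 * l p.2) (by fun_prop)
    · intro x l
      simp_rw [Fintype.sum_prod_type, Finset.mul_sum]
      rw [Finset.sum_comm]
      refine Finset.sum_congr rfl fun i _ => Finset.sum_congr rfl fun k _ => by ring
    · intro l
      simp_rw [Fintype.sum_prod_type, mul_pow, ← Finset.mul_sum, ← Finset.sum_mul, hc, one_mul]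
  have h2 := h1.comp ((mp_curry (ι := ι) (κ := κ) s).symm)
  exact h2

/-- the resampling map -/
def resamp {ι κ : Type*} [Fintype ι] (e f : ι → ℝ)
    (p : (ι → κ → ℝ) × (κ → ℝ) × (κ → ℝ)) (j : ι) (k : κ) : ℝ :=
  p.1 j k - e j * (∑ i, e i * p.1 i k) - f j * (∑ i, f i * p.1 i k) + e j * p.2.1 k + f j * p.2.2 k

lemma mp_resamp {ι κ : Type*} [Fintype ι] [Fintype κ] (s : ℝ≥0) (e f : ι → ℝ)
    (he : ∑ i, e i ^ 2 = 1) (hf : ∑ i, f i ^ 2 = 1) (hef : ∑ i, e i * f i = 0) :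
    MeasurePreserving (resamp (κ := κ) e f)
      ((Measure.pi fun _ : ι => gam s κ).prod ((gam s κ).prod (gam s κ)))
      (Measure.pi fun _ : ι => gam s κ) := by
  have h1 : MeasurePreserving (fun (x : (ι × κ) ⊕ (κ ⊕ κ) → ℝ) (q : ι × κ) =>
      x (Sum.inl q) - e q.1 * (∑ i, e i * x (Sum.inl (i, q.2)))
        - f q.1 * (∑ i, f i * x (Sum.inl (i, q.2)))
        + e q.1 * x (Sum.inr (Sum.inl q.2)) + f q.1 * x (Sum.inr (Sum.inr q.2)))
      (gam s ((ι × κ) ⊕ (κ ⊕ κ))) (gam s (ι × κ)) := by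
    apply cois s _ (fun l => Sum.elim (fun q => l q - e q.1 * (∑ i, e i * l (i, q.2))
        - f q.1 * (∑ i, f i * l (i, q.2))) (Sum.elim (fun k => ∑ i, e i * l (i, k))
          (fun k => ∑ i, f i * l (i, k)))) (by fun_prop)
    · intro x l
      simp only [Fintype.sum_sum_type, Fintype.sum_prod_type_right, Sum.elim_inl, Sum.elim_inr,
        ← Finset.sum_add_distrib]
      refine Finset.sum_congr rfl fun k _ => ?_
      simp only [mul_add, mul_sub, add_mul, sub_mul, Finset.sum_add_distrib,
        Finset.sum_sub_distrib]
      have : ∀ (a : ℝ) (u : ι → ℝ) (w : ι → ℝ), ∑ i, w i * (u i * a) = a * ∑ i, u i * w i := by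
        intro a u w; rw [Finset.mul_sum]; exact Finset.sum_congr rfl fun i _ => by ring
      have h' : ∀ (a : ℝ) (u : ι → ℝ) (w : ι → ℝ), ∑ i, u i * a * w i = a * ∑ i, u i * w i := by
        intro a u w; rw [Finset.mul_sum]; exact Finset.sum_congr rfl fun i _ => by ring
      simp only [this, h']
      ring
    · intro l
      simp only [Fintype.sum_sum_type, Fintype.sum_prod_type_right, Sum.elim_inl, Sum.elim_inr,
        ← Finset.sum_add_distrib]
      refine Finset.sum_congr rfl fun k _ => ?_
      set a := ∑ i, e i * l (i, k)
      set b := ∑ i, f i * l (i, k)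
      have : ∀ i, (l (i,k) - e i * a - f i * b)^2 = l (i,k)^2 + a^2 * e i ^2 + b^2 * f i ^ 2
        - 2 * a * (e i * l (i,k)) - 2 * b * (f i * l (i,k)) + 2 * a * b * (e i * f i) := by
        intro i; ring
      simp only [this, Finset.sum_add_distrib, Finset.sum_sub_distrib, ← Finset.mul_sum, he, hf, hef]
      change _ - 2 * a * a - 2 * b * b + _ + _ = _
      ring
  have h2 := (measurePreserving_sumPiEquivProdPi (fun _ : κ ⊕ κ => gaussianReal 0 s)).symm
  have h3 := (measurePreserving_sumPiEquivProdPi (fun _ : (ι × κ) ⊕ (κ ⊕ κ) => gaussianReal 0 s)).symm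
  have h4 := ((mp_curry (ι := ι) (κ := κ) s).symm.prod h2)
  have h5 := (mp_curry (ι := ι) (κ := κ) s).comp (h1.comp (h3.comp h4))
  exact h5

/-- projections on two orthonormal directions -/
lemma mp_proj2 {ι κ : Type*} [Fintype ι] [Fintype κ] (s : ℝ≥0) (y z : κ → ℝ)
    (hy : ∑ i, y i ^ 2 = 1) (hz : ∑ i, z i ^ 2 = 1) (hyz : ∑ i, y i * z i = 0) :
    MeasurePreserving (fun V : ι → κ → ℝ => ((fun j => ∑ k, V j k * y k), (fun j => ∑ k, V j k * z k)))
      (Measure.pi fun _ : ι => gam s κ) ((gam s ι).prod (gam s ι)) := by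
  have h1 : MeasurePreserving (fun (x : ι × κ → ℝ) (q : ι ⊕ ι) =>
      Sum.elim (fun j => ∑ k, x (j, k) * y k) (fun j => ∑ k, x (j, k) * z k) q)
      (gam s (ι × κ)) (gam s (ι ⊕ ι)) := by
    apply cois s _ (fun l q => l (Sum.inl q.1) * y q.2 + l (Sum.inr q.1) * z q.2)
    · rw [measurable_pi_iff]
      rintro (j | j) <;> simp only [Sum.elim_inl, Sum.elim_inr] <;> fun_prop
    · intro x l
      simp only [Fintype.sum_sum_type, Fintype.sum_prod_type, Sum.elim_inl, Sum.elim_inr,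
        ← Finset.sum_add_distrib, Finset.mul_sum]
      refine Finset.sum_congr rfl fun i _ => Finset.sum_congr rfl fun k _ => by ring
    · intro l
      simp only [Fintype.sum_sum_type, Fintype.sum_prod_type, 
        ← Finset.sum_add_distrib]
      refine Finset.sum_congr rfl fun i _ => ?_
      have : ∀ k, (l (Sum.inl i) * y k + l (Sum.inr i) * z k) ^ 2 = l (Sum.inl i) ^2 * y k ^ 2
        + l (Sum.inr i)^2 * z k ^ 2 + 2 * l (Sum.inl i) * l (Sum.inr i) * (y k * z k) := by
        intro k; ring
      simp only [this, Finset.sum_add_distrib, ← Finset.mul_sum, hy, hz, hyz]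
      ring
  have h2 := (measurePreserving_sumPiEquivProdPi (fun _ : ι ⊕ ι => gaussianReal 0 s))
  have h5 := h2.comp (h1.comp (mp_curry (ι := ι) (κ := κ) s).symm)
  exact h5

/-- projection on one unit direction -/
lemma mp_proj1 {ι κ : Type*} [Fintype ι] [Fintype κ] (s : ℝ≥0) (y : κ → ℝ)
    (hy : ∑ i, y i ^ 2 = 1) :
    MeasurePreserving (fun V : ι → κ → ℝ => (fun j => ∑ k, V j k * y k))
      (Measure.pi fun _ : ι => gam s κ) (gam s ι) := by
  have h1 : MeasurePreserving (fun (x : ι × κ → ℝ) (j : ι) => ∑ k, x (j, k) * y k)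
      (gam s (ι × κ)) (gam s ι) := by
    apply cois s _ (fun l q => l q.1 * y q.2) (by fun_prop)
    · intro x l
      simp only [Fintype.sum_prod_type, Finset.mul_sum]
      refine Finset.sum_congr rfl fun i _ => Finset.sum_congr rfl fun k _ => by ring
    · intro l
      simp only [Fintype.sum_prod_type, mul_pow, ← Finset.mul_sum, hy, mul_one]
  exact h1.comp (mp_curry (ι := ι) (κ := κ) s).symm

lemma mp_fun1 {κ : Type*} [Fintype κ] (s : ℝ≥0) (y : κ → ℝ)
    (hy : ∑ i, y i ^ 2 = 1) :
    MeasurePreserving (fun V : κ → ℝ => ∑ k, y k * V k) (gam s κ) (gaussianReal 0 s) := by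
  have h := cois (κ := Unit) s (fun V _ => ∑ k, y k * V k) (fun l k => l () * y k) (by fun_prop)
    (by intro x l; simp [Finset.mul_sum, mul_assoc])
    (by intro l; simp [mul_pow, ← Finset.mul_sum, hy])
  exact (measurePreserving_eval (fun _ : Unit => gaussianReal 0 s) ()).comp h

lemma gauss_upper (s : ℝ≥0) (hs : s ≠ 0) (t : ℝ) (ht : 0 ≤ t) :
    (gaussianReal 0 s).real {x | t ≤ x} ≤ Real.exp (-(t ^ 2 / (2 * s))) := by
  have hs' : (0:ℝ) < s := by positivity
  have h := measure_ge_le_exp_mul_mgf (μ := gaussianReal 0 s) (X := id) (t := t / s) t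
    (by positivity) (by simpa using integrable_exp_mul_gaussianReal (t / s))
  rw [mgf_id_gaussianReal] at h
  refine h.trans ?_
  rw [← Real.exp_add]
  apply Real.exp_le_exp.2
  apply le_of_eq
  field_simp
  ring

lemma gauss_lower (s : ℝ≥0) (hs : s ≠ 0) (t : ℝ) (ht : 0 ≤ t) :
    (gaussianReal 0 s).real {x | x ≤ -t} ≤ Real.exp (-(t ^ 2 / (2 * s))) := by
  have hs' : (0:ℝ) < s := by positivity
  have h := measure_le_le_exp_mul_mgf (μ := gaussianReal 0 s) (X := id) (t := -(t / s)) (-t)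
    (by have : 0 ≤ t / s := by positivity
        linarith) (by simpa using integrable_exp_mul_gaussianReal (-(t / s)))
  rw [mgf_id_gaussianReal] at h
  refine h.trans ?_
  rw [← Real.exp_add]
  apply Real.exp_le_exp.2
  apply le_of_eq
  field_simp
  ring

lemma gauss_abs (s : ℝ≥0) (hs : s ≠ 0) (t : ℝ) (ht : 0 ≤ t) :
    (gaussianReal 0 s).real {x | t < |x|} ≤ 2 * Real.exp (-(t ^ 2 / (2 * s))) := by
  have : {x : ℝ | t < |x|} ⊆ {x | t ≤ x} ∪ {x | x ≤ -t} := by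
    intro x hx
    rcases lt_abs.1 (show t < |x| from hx) with h | h
    · left; exact h.le
    · right; show x ≤ -t; linarith
  calc _ ≤ _ := measureReal_mono this
    _ ≤ _ := measureReal_union_le _ _
    _ ≤ _ := by linarith [gauss_upper s hs t ht, gauss_lower s hs t ht]

lemma integral_exp_sq (s : ℝ≥0) (hs : s ≠ 0) (l : ℝ) (hl : 2 * l < 1) :
    ∫ x, Real.exp (l / s * x ^ 2) ∂(gaussianReal 0 s) = (√(1 - 2 * l))⁻¹ := by
  have hs' : (0:ℝ) < s := by positivity
  rw [integral_gaussianReal_eq_integral_smul hs]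
  have : ∀ x : ℝ, gaussianPDFReal 0 s x • Real.exp (l / s * x ^ 2)
      = (√(2 * Real.pi * s))⁻¹ * Real.exp (-((1 - 2 * l) / (2 * s)) * x ^ 2) := by
    intro x
    rw [gaussianPDFReal, smul_eq_mul, mul_assoc, ← Real.exp_add]
    congr 2
    field_simp
    ring
  simp_rw [this]
  rw [integral_const_mul, integral_gaussian]
  have h1 : Real.pi / ((1 - 2 * l) / (2 * s)) = (2 * Real.pi * s) * (1 - 2 * l)⁻¹ := by
    have : 1 - 2 * l ≠ 0 := by linarith
    field_simp
  rw [h1, Real.sqrt_mul (show 0 ≤ 2 * Real.pi * (s:ℝ) by positivity), Real.sqrt_inv, ← mul_assoc, inv_mul_cancel₀, one_mul]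
  have := Real.pi_pos
  positivity

lemma inv_sqrt_le (l : ℝ) (hl : |l| ≤ 1 / 4) : (√(1 - 2 * l))⁻¹ ≤ Real.exp (l + 2 * l ^ 2) := by
  rw [abs_le] at hl
  have h1 : 0 < 1 - 2 * l := by linarith
  rw [inv_le_comm₀ (by positivity) (by positivity), ← Real.exp_neg]
  apply Real.le_sqrt_of_sq_le
  rw [← Real.exp_nat_mul]
  set y := 2 * l with hy
  have h2 : ((2:ℕ):ℝ) * -(l + 2 * l^2) = -(y + y ^ 2) := by push_cast; rw [hy]; ring
  rw [h2, Real.exp_neg]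
  rw [inv_le_comm₀ (by positivity) h1]
  rw [inv_le_iff_one_le_mul₀ h1]
  rcases le_total 0 y with h | h
  · have hz : 0 ≤ y + y^2 := by positivity
    have := Real.quadratic_le_exp_of_nonneg hz
    have h3 : (1 + (y + y^2) + (y+y^2)^2/2) * (1 - y) ≤ Real.exp (y + y^2) * (1 - y) :=
      mul_le_mul_of_nonneg_right this h1.le
    have h4 : (1 + (y + y^2) + (y+y^2)^2/2) * (1 - y) = 1 + y^2/2 * (1 - y - y^2 - y^3) := by ring
    have hy2 : y ≤ 1/2 := by linarith
    have h5 : 0 ≤ 1 - y - y^2 - y^3 := by nlinarith [mul_nonneg h h, mul_nonneg h (mul_nonneg h h)]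
    have h6 : 0 ≤ y^2/2 * (1 - y - y^2 - y^3) := by positivity
    linarith
  · have := Real.add_one_le_exp (y + y^2)
    have h3 : (y + y^2 + 1) * (1 - y) ≤ Real.exp (y + y^2) * (1 - y) :=
      mul_le_mul_of_nonneg_right this h1.le
    have h4 : (y + y^2 + 1) * (1 - y) = 1 - y^3 := by ring
    have h5 : y^3 ≤ 0 := by nlinarith [sq_nonneg y]
    linarith

lemma mgf_chi (s : ℝ≥0) (hs : s ≠ 0) {ι : Type*} [Fintype ι] (l : ℝ) (hl : |l| ≤ 1 / 4) :
    Integrable (fun x : ι → ℝ => Real.exp (l / s * ∑ i, x i ^ 2)) (gam s ι) ∧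
    mgf (fun x : ι → ℝ => ∑ i, x i ^ 2) (gam s ι) (l / s)
      ≤ Real.exp (Fintype.card ι * (l + 2 * l ^ 2)) := by
  have hl' := abs_le.1 hl
  have h0 := integral_exp_sq s hs l (by linarith)
  have hpos : 0 < (√(1 - 2 * l))⁻¹ := by
    have : 0 < 1 - 2 * l := by linarith
    positivity
  have hInteg : Integrable (fun x : ℝ => Real.exp (l / s * x ^ 2)) (gaussianReal 0 s) := by
    by_contra h
    rw [integral_undef h] at h0
    linarith
  have he : ∀ x : ι → ℝ, Real.exp (l / s * ∑ i, x i ^ 2) = ∏ i, Real.exp (l / s * x i ^ 2) := by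
    intro x; rw [Finset.mul_sum, Real.exp_sum]
  constructor
  · simp_rw [he]
    exact Integrable.fintype_prod (f := fun _ (x : ℝ) => Real.exp (l / s * x ^ 2)) fun _ => hInteg
  · rw [mgf]
    simp_rw [he]
    rw [integral_fintype_prod_eq_prod (f := fun _ (x : ℝ) => Real.exp (l / s * x ^ 2))]
    simp_rw [h0]
    rw [Finset.prod_const, Finset.card_univ, Real.exp_nat_mul]
    exact pow_le_pow_left₀ hpos.le (inv_sqrt_le l hl) _

lemma chi2 (s : ℝ≥0) (hs : s ≠ 0) {ι : Type*} [Fintype ι] (ε : ℝ) (h0 : 0 ≤ ε) (h1 : ε ≤ 1) :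
    (gam s ι).real {x | ε * (Fintype.card ι * s) < |∑ i, x i ^ 2 - Fintype.card ι * s|}
      ≤ 2 * Real.exp (-(Fintype.card ι * ε ^ 2 / 8)) := by
  have hs' : (0:ℝ) < s := by positivity
  set N : ℝ := ((Fintype.card ι : ℕ) : ℝ)
  have hsub : {x : ι → ℝ | ε * (N * s) < |∑ i, x i ^ 2 - N * s|} ⊆
      {x | N * s * (1 + ε) ≤ ∑ i, x i ^ 2} ∪ {x | ∑ i, x i ^ 2 ≤ N * s * (1 - ε)} := by
    intro x hx
    rw [Set.mem_ofPred_eq] at hx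
    rcases lt_abs.1 hx with h | h
    · left; rw [Set.mem_ofPred_eq]; linarith
    · right; rw [Set.mem_ofPred_eq]; linarith
  obtain ⟨i1, m1⟩ := mgf_chi s hs (ι := ι) (ε / 4) (by rw [abs_of_nonneg (by positivity)]; linarith)
  obtain ⟨i2, m2⟩ := mgf_chi s hs (ι := ι) (-(ε / 4))
    (by rw [abs_neg, abs_of_nonneg (by positivity)]; linarith)
  have t1 := measure_ge_le_exp_mul_mgf (μ := gam s ι) (X := fun x => ∑ i, x i ^ 2)
    (t := ε / 4 / s) (N * s * (1 + ε)) (by positivity) i1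
  have t2 := measure_le_le_exp_mul_mgf (μ := gam s ι) (X := fun x => ∑ i, x i ^ 2)
    (t := -(ε / 4) / s) (N * s * (1 - ε)) (by
      rw [neg_div]; have : 0 ≤ ε / 4 / s := by positivity
      linarith) i2
  have t1' := t1.trans (mul_le_mul_of_nonneg_left m1 (Real.exp_pos _).le)
  have t2' := t2.trans (mul_le_mul_of_nonneg_left m2 (Real.exp_pos _).le)
  rw [← Real.exp_add] at t1' t2'
  have e1 : -(ε / 4 / s) * (N * s * (1 + ε)) + N * (ε / 4 + 2 * (ε / 4) ^ 2) = -(N * ε ^ 2 / 8) := by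
    field_simp; ring
  have e2 : -(-(ε / 4) / s) * (N * s * (1 - ε)) + N * (-(ε / 4) + 2 * (-(ε / 4)) ^ 2)
      = -(N * ε ^ 2 / 8) := by
    field_simp; ring
  rw [e1] at t1'
  rw [e2] at t2'
  calc _ ≤ _ := measureReal_mono hsub
    _ ≤ _ := measureReal_union_le _ _
    _ ≤ _ := by linarith

lemma mp_update {ι : Type*} [Fintype ι] [DecidableEq ι] (s : ℝ≥0) (i : ι) :
    MeasurePreserving (fun p : (ι → ℝ) × ℝ => Function.update p.1 i p.2)
      ((gam s ι).prod (gaussianReal 0 s)) (gam s ι) := by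
  have h1 : MeasurePreserving (fun (x : ι ⊕ Unit → ℝ) =>
      Function.update (fun j => x (Sum.inl j)) i (x (Sum.inr ())))
      (gam s (ι ⊕ Unit)) (gam s ι) := by
    apply cois s _ (fun l => Sum.elim (Function.update l i 0) (fun _ => l i))
    · rw [measurable_pi_iff]
      intro j
      by_cases h : j = i
      · subst h; simp only [Function.update_self]; fun_prop
      · simp only [Function.update_of_ne h]; fun_prop
    · intro x l
      simp only [Fintype.sum_sum_type, Sum.elim_inl, Sum.elim_inr, Finset.univ_unique,
        Finset.sum_singleton]
      rw [← Finset.add_sum_erase _ _ (Finset.mem_univ i),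
        ← Finset.add_sum_erase _ _ (Finset.mem_univ i)]
      simp only [Function.update_self, zero_mul, zero_add]
      rw [add_comm]
      congr 1
      refine Finset.sum_congr rfl fun j hj => ?_
      rw [Function.update_of_ne (Finset.ne_of_mem_erase hj),
        Function.update_of_ne (Finset.ne_of_mem_erase hj)]
    · intro l
      simp only [Fintype.sum_sum_type, Sum.elim_inl, Sum.elim_inr, Finset.univ_unique,
        Finset.sum_singleton]
      rw [← Finset.add_sum_erase _ _ (Finset.mem_univ i),
        ← Finset.add_sum_erase _ (fun k => l k ^ 2) (Finset.mem_univ i)]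
      simp only [Function.update_self, ne_eq, OfNat.ofNat_ne_zero, not_false_eq_true, zero_pow, zero_add]
      rw [add_comm]
      congr 1
      refine Finset.sum_congr rfl fun j hj => ?_
      rw [Function.update_of_ne (Finset.ne_of_mem_erase hj)]
  have h2 := (measurePreserving_sumPiEquivProdPi (fun _ : ι ⊕ Unit => gaussianReal 0 s)).symm
  have h3 := (measurePreserving_funUnique (gaussianReal 0 s) Unit).symm
  have h4 := (MeasurePreserving.id (gam s ι)).prod h3
  exact h1.comp (h2.comp h4)

/-- one-dimensional shift -/
lemma shift1 (s : ℝ≥0) (hs : s ≠ 0) (E : Set ℝ) (hE : MeasurableSet E) (h L : ℝ) (hh : 0 ≤ h) :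
    gaussianReal 0 s E ≤ ENNReal.ofReal (Real.exp (h * L / s)) * gaussianReal 0 s {x | x + h ∈ E}
      + gaussianReal 0 s {x | x ≤ h - L} := by
  have hs' : (0:ℝ) < s := by positivity
  have hsub : E ⊆ (E ∩ {x | h - L < x}) ∪ {x | x ≤ h - L} := by
    intro x hx
    rcases lt_or_ge (h - L) x with h' | h'
    · left; exact ⟨hx, h'⟩
    · right; exact h'
  have hmE : MeasurableSet (E ∩ {x | h - L < x}) := hE.inter measurableSet_Ioi
  have key : gaussianReal 0 s (E ∩ {x | h - L < x}) ≤
      ENNReal.ofReal (Real.exp (h * L / s)) * gaussianReal 0 s {x | x + h ∈ E} := by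
    rw [gaussianReal_apply _ hs, gaussianReal_apply _ hs, ← lintegral_indicator hmE,
      ← lintegral_const_mul _ (measurable_gaussianPDF _ _),
      ← lintegral_indicator (by exact (measurable_add_const h) hE),
      ← lintegral_add_right_eq_self _ h]
    apply lintegral_mono
    intro x
    simp only [Set.indicator, Set.mem_inter_iff, Set.mem_ofPred_eq]
    split_ifs with h1 h2
    · rw [gaussianPDF, gaussianPDF, ← ENNReal.ofReal_mul (Real.exp_pos _).le]
      apply ENNReal.ofReal_le_ofReal
      rw [gaussianPDFReal, gaussianPDFReal, mul_left_comm, ← Real.exp_add]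
      apply mul_le_mul_of_nonneg_left _ (by positivity)
      apply Real.exp_le_exp.2
      rw [div_add_div _ _ (by positivity) (by positivity), div_le_div_iff₀ (by positivity) (by positivity)]
      have h3 : -L < x := by
        have h12 : h - L < x + h := h1.2
        linarith
      have : 0 ≤ h * (x + L) := mul_nonneg hh (by linarith)
      have h4 : -(x + h - 0)^2 ≤ 2 * h * L - (x-0)^2 := by nlinarith
      have h5 := mul_le_mul_of_nonneg_right h4 (show (0:ℝ) ≤ 2 * s * s by positivity)
      nlinarith
    · exact absurd h1.1 h2
    · exact bot_le
    · exact le_rfl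
  calc _ ≤ _ := measure_mono hsub
    _ ≤ _ := measure_union_le _ _
    _ ≤ _ := by gcongr

/-- coordinate i beaten with margin θ -/
def beat {ι : Type*} (i : ι) (θ : ℝ) : Set (ι → ℝ) := {x | ∃ j, j ≠ i ∧ x i + θ ≤ x j}

lemma measurable_beat {ι : Type*} [Fintype ι] (i : ι) (θ : ℝ) : MeasurableSet (beat i θ) := by
  have : beat i θ = ⋃ j, ⋃ (_ : j ≠ i), {x : ι → ℝ | x i + θ ≤ x j} := by
    ext x; simp [beat]
  rw [this]
  refine MeasurableSet.iUnion fun j => MeasurableSet.iUnion fun _ => ?_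
  exact measurableSet_le (by fun_prop) (by fun_prop)

lemma shift_beat {ι : Type*} [Fintype ι] (s : ℝ≥0) (hs : s ≠ 0) (i : ι) (θ h L : ℝ)
    (hh : 0 ≤ h) :
    (gam s ι).real (beat i θ) ≤ Real.exp (h * L / s) * (gam s ι).real (beat i (θ + h))
      + (gaussianReal 0 s).real {x | x ≤ h - L} := by
  classical
  have hm := mp_update s i
  have hb : ∀ θ, gam s ι (beat i θ) = ∫⁻ x, gaussianReal 0 s
      {y | Function.update x i y ∈ beat i θ} ∂(gam s ι) := by
    intro θ
    rw [← hm.measure_preimage (measurable_beat i θ).nullMeasurableSet,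
      Measure.prod_apply (hm.measurable (measurable_beat i θ))]
    rfl
  have hE : ∀ (x : ι → ℝ) θ, MeasurableSet {y | Function.update x i y ∈ beat i θ} := by
    intro x θ
    exact (measurable_update x) (measurable_beat i θ)
  have hsh : ∀ x : ι → ℝ, {y | y + h ∈ {y | Function.update x i y ∈ beat i θ}}
      = {y | Function.update x i y ∈ beat i (θ + h)} := by
    intro x; ext y
    simp only [beat, Set.mem_ofPred_eq, Function.update_self]
    constructor
    · rintro ⟨j, hj, h'⟩
      refine ⟨j, hj, ?_⟩
      rw [Function.update_of_ne hj] at h' ⊢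
      linarith
    · rintro ⟨j, hj, h'⟩
      refine ⟨j, hj, ?_⟩
      rw [Function.update_of_ne hj] at h' ⊢
      linarith
  have main : gam s ι (beat i θ) ≤ ENNReal.ofReal (Real.exp (h * L / s)) * gam s ι (beat i (θ + h))
      + gaussianReal 0 s {x | x ≤ h - L} := by
    rw [hb, hb]
    calc _ ≤ ∫⁻ x, (ENNReal.ofReal (Real.exp (h * L / s)) * gaussianReal 0 s
        {y | Function.update x i y ∈ beat i (θ + h)} + gaussianReal 0 s {x | x ≤ h - L}) ∂(gam s ι) := by
          apply lintegral_mono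
          intro x
          have := shift1 s hs _ (hE x θ) h L hh
          rw [hsh] at this
          exact this
      _ ≤ _ := by
          rw [lintegral_add_right _ measurable_const, lintegral_const_mul' _ _ ENNReal.ofReal_ne_top]
          simp
  have h2 := ENNReal.toReal_mono (by finiteness) main
  rw [ENNReal.toReal_add (by finiteness) (by finiteness), ENNReal.toReal_mul,
    ENNReal.toReal_ofReal (Real.exp_pos _).le] at h2
  exact h2

lemma beat_swap {ι : Type*} [Fintype ι] (s : ℝ≥0) (i i' : ι) (θ : ℝ) :
    (gam s ι).real (beat i θ) = (gam s ι).real (beat i' θ) := by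
  classical
  have h : MeasurePreserving (fun x : ι → ℝ => fun j => x (Equiv.swap i i' j)) (gam s ι) (gam s ι) := by
    apply cois s _ (fun l j => l (Equiv.swap i i' j)) (by fun_prop)
    · intro x l
      rw [← Equiv.sum_comp (Equiv.swap i i')]
      simp
    · intro l
      exact Equiv.sum_comp (Equiv.swap i i') (fun k => l k ^ 2)
  rw [← h.measureReal_preimage (measurable_beat i θ).nullMeasurableSet]
  congr 1
  ext x
  simp only [beat, Set.mem_preimage, Set.mem_ofPred_eq, Equiv.swap_apply_left]
  constructor
  · rintro ⟨j, hj, h'⟩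
    exact ⟨Equiv.swap i i' j, fun h => hj ((Equiv.swap i i').injective (h.trans (Equiv.swap_apply_left i i').symm)), h'⟩
  · rintro ⟨j, hj, h'⟩
    exact ⟨Equiv.swap i i' j, fun h => hj ((Equiv.swap i i').injective (h.trans (Equiv.swap_apply_right i i').symm)), by simpa using h'⟩

lemma fub {α β : Type*} [MeasurableSpace α] [MeasurableSpace β] (μ : Measure α) (ν : Measure β)
    [IsProbabilityMeasure μ] [IsProbabilityMeasure ν] (E : Set (α × β)) (hE : MeasurableSet E)
    (G : Set β) (b1 b2 : ℝ) (hG : ν.real Gᶜ ≤ b1) (hb2 : 0 ≤ b2)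
    (h : ∀ y ∈ G, μ.real {x | (x, y) ∈ E} ≤ b2) : (μ.prod ν).real E ≤ b1 + b2 := by
  have hb1 : 0 ≤ b1 := measureReal_nonneg.trans hG
  have key : (μ.prod ν) E ≤ ENNReal.ofReal (b1 + b2) := by
    rw [Measure.prod_apply_symm hE]
    calc _ ≤ ∫⁻ y, (Gᶜ.indicator (fun _ => 1) y + ENNReal.ofReal b2) ∂ν := by
          apply lintegral_mono
          intro y
          by_cases hy : y ∈ G
          · have := h y hy
            rw [Measure.real, ← ENNReal.le_ofReal_iff_toReal_le (by finiteness) hb2] at this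
            exact this.trans le_add_self
          · simp only [Set.indicator, Set.mem_compl_iff, hy, not_false_eq_true, if_true]
            exact prob_le_one.trans le_self_add
      _ = ∫⁻ y, Gᶜ.indicator (fun _ => 1) y ∂ν + ENNReal.ofReal b2 := by
          rw [lintegral_add_right _ measurable_const]; simp
      _ ≤ 1 * ν Gᶜ + ENNReal.ofReal b2 := by
          gcongr; exact lintegral_indicator_const_le _ _
      _ ≤ _ := by
          rw [one_mul, ENNReal.ofReal_add hb1 hb2]
          gcongr
          rwa [Measure.real, ← ENNReal.le_ofReal_iff_toReal_le (by finiteness) hb1] at hG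
  rw [Measure.real]
  exact ENNReal.toReal_le_of_le_ofReal (by positivity) key

lemma mp_pair {κ : Type*} [Fintype κ] (s : ℝ≥0) (c1 c2 : ℝ) (hc : c1 ^ 2 + c2 ^ 2 = 1) :
    MeasurePreserving (fun (p : (κ → ℝ) × (κ → ℝ)) k => c1 * p.1 k + c2 * p.2 k)
      ((gam s κ).prod (gam s κ)) (gam s κ) := by
  have h1 : MeasurePreserving (fun (x : κ ⊕ κ → ℝ) k => c1 * x (Sum.inl k) + c2 * x (Sum.inr k))
      (gam s (κ ⊕ κ)) (gam s κ) := by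
    apply cois s _ (fun l => Sum.elim (fun k => c1 * l k) (fun k => c2 * l k)) (by fun_prop)
    · intro x l
      simp only [Fintype.sum_sum_type, Sum.elim_inl, Sum.elim_inr, ← Finset.sum_add_distrib]
      exact Finset.sum_congr rfl fun i _ => by ring
    · intro l
      simp only [Fintype.sum_sum_type, Sum.elim_inl, Sum.elim_inr, ← Finset.sum_add_distrib]
      exact Finset.sum_congr rfl fun i _ => by linear_combination (l i ^ 2) * hc
  have h2 := (measurePreserving_sumPiEquivProdPi (fun _ : κ ⊕ κ => gaussianReal 0 s)).symm
  exact h1.comp h2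

/-- nearly orthonormal pair -/
def PG {κ : Type*} [Fintype κ] (ε : ℝ) (y z : κ → ℝ) : Prop :=
  |∑ k, y k ^ 2 - 1| ≤ ε ∧ |∑ k, z k ^ 2 - 1| ≤ ε ∧ |∑ k, y k * z k| ≤ ε

lemma pair_bad {κ : Type*} [Fintype κ] (s : ℝ≥0) (hs : (Fintype.card κ : ℝ) * s = 1)
    (ε : ℝ) (h0 : 0 ≤ ε) (h1 : ε ≤ 1) :
    ((gam s κ).prod (gam s κ)).real {p | PG ε p.1 p.2}ᶜ
      ≤ 8 * Real.exp (-(Fintype.card κ * ε ^ 2 / 8)) := by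
  have hs0 : s ≠ 0 := by rintro rfl; simp at hs
  have hc := chi2 s hs0 (ι := κ) ε h0 h1
  rw [hs, mul_one] at hc
  set bad : Set (κ → ℝ) := {x | ε < |∑ i, x i ^ 2 - 1|} with hbad
  have hmb : MeasurableSet bad := measurableSet_lt measurable_const (by fun_prop)
  have hp : ∀ c1 c2 : ℝ, c1 ^ 2 + c2 ^ 2 = 1 → ((gam s κ).prod (gam s κ)).real
      ((fun (p : (κ → ℝ) × (κ → ℝ)) k => c1 * p.1 k + c2 * p.2 k) ⁻¹' bad)
        ≤ 2 * Real.exp (-(Fintype.card κ * ε ^ 2 / 8)) := by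
    intro c1 c2 h
    rw [(mp_pair s c1 c2 h).measureReal_preimage hmb.nullMeasurableSet]
    exact hc
  have hr : (√(1/2) : ℝ) ^ 2 = 1 / 2 := Real.sq_sqrt (by norm_num)
  set r : ℝ := √(1/2)
  have p1 := hp 1 0 (by norm_num)
  have p2 := hp 0 1 (by norm_num)
  have p3 := hp r r (by linarith)
  have p4 := hp r (-r) (by rw [neg_sq]; linarith)
  set B1 := ((fun (p : (κ → ℝ) × (κ → ℝ)) k => 1 * p.1 k + 0 * p.2 k) ⁻¹' bad)
  set B2 := ((fun (p : (κ → ℝ) × (κ → ℝ)) k => 0 * p.1 k + 1 * p.2 k) ⁻¹' bad)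
  set B3 := ((fun (p : (κ → ℝ) × (κ → ℝ)) k => r * p.1 k + r * p.2 k) ⁻¹' bad)
  set B4 := ((fun (p : (κ → ℝ) × (κ → ℝ)) k => r * p.1 k + (-r) * p.2 k) ⁻¹' bad)
  have hsub : {p : (κ → ℝ) × (κ → ℝ) | PG ε p.1 p.2}ᶜ ⊆ B1 ∪ B2 ∪ (B3 ∪ B4) := by
    intro p
    contrapose!
    intro hp
    simp only [Set.mem_union, not_or] at hp
    obtain ⟨⟨q1, q2⟩, q3, q4⟩ := hp
    rw [Set.mem_compl_iff, not_not, Set.mem_ofPred_eq, PG]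
    simp only [B1, B2, B3, B4, bad, Set.mem_preimage, Set.mem_ofPred_eq, not_lt, one_mul, zero_mul,
      add_zero, zero_add] at q1 q2 q3 q4
    refine ⟨q1, q2, ?_⟩
    have e3 : ∑ k, (r * p.1 k + r * p.2 k) ^ 2 =
        1 / 2 * ∑ k, p.1 k ^ 2 + 1 / 2 * ∑ k, p.2 k ^ 2 + ∑ k, p.1 k * p.2 k := by
      simp only [Finset.mul_sum, ← Finset.sum_add_distrib]
      exact Finset.sum_congr rfl fun i _ => by linear_combination (p.1 i + p.2 i) ^ 2 * hr
    have e4 : ∑ k, (r * p.1 k + -r * p.2 k) ^ 2 =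
        1 / 2 * ∑ k, p.1 k ^ 2 + 1 / 2 * ∑ k, p.2 k ^ 2 - ∑ k, p.1 k * p.2 k := by
      simp only [Finset.mul_sum, ← Finset.sum_add_distrib, ← Finset.sum_sub_distrib]
      exact Finset.sum_congr rfl fun i _ => by linear_combination (p.1 i - p.2 i) ^ 2 * hr
    rw [e3] at q3
    rw [e4] at q4
    rw [abs_le] at *
    constructor <;> linarith [q3.1, q3.2, q4.1, q4.2]
  calc _ ≤ _ := measureReal_mono hsub
    _ ≤ _ := measureReal_union_le _ _
    _ ≤ _ := add_le_add (measureReal_union_le _ _) (measureReal_union_le _ _)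
    _ ≤ _ := by linarith

/-- all coordinates small -/
lemma coord_bad {ι : Type*} [Fintype ι] (s : ℝ≥0) (hs : s ≠ 0) (ε : ℝ) (h0 : 0 ≤ ε) :
    (gam s ι).real {x | ∃ j, ε < |x j|} ≤
      Fintype.card ι * (2 * Real.exp (-(ε ^ 2 / (2 * s)))) := by
  have : {x : ι → ℝ | ∃ j, ε < |x j|} = ⋃ j, {x | ε < |x j|} := by ext; simp
  rw [this]
  refine (measureReal_iUnion_fintype_le _).trans ?_
  rw [← nsmul_eq_mul, ← Finset.card_univ]
  apply Finset.sum_le_card_nsmul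
  intro j _
  have h := measurePreserving_eval (fun _ : ι => gaussianReal 0 s) j
  have h2 := h.measureReal_preimage (s := {x : ℝ | ε < |x|})
    (measurableSet_lt measurable_const (by fun_prop)).nullMeasurableSet
  refine le_trans (le_of_eq ?_) (gauss_abs s hs ε h0)
  exact h2

/-- tail of x-good -/
lemma x_bad {ι : Type*} [Fintype ι] (s : ℝ≥0) (hs : s ≠ 0) (ε : ℝ) (h0 : 0 ≤ ε) (e f : ι → ℝ)
    (he : ∑ i, e i ^ 2 = 1) (hf : ∑ i, f i ^ 2 = 1) :
    (gam s ι).real {x | (∀ j, |x j| ≤ ε) ∧ |∑ i, e i * x i| ≤ ε ∧ |∑ i, f i * x i| ≤ ε}ᶜ ≤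
      (2 * Fintype.card ι + 4) * Real.exp (-(ε ^ 2 / (2 * s))) := by
  have hsub : {x : ι → ℝ | (∀ j, |x j| ≤ ε) ∧ |∑ i, e i * x i| ≤ ε ∧ |∑ i, f i * x i| ≤ ε}ᶜ ⊆
      {x | ∃ j, ε < |x j|} ∪ ({x | ε < |∑ i, e i * x i|} ∪ {x | ε < |∑ i, f i * x i|}) := by
    intro x
    contrapose!
    intro hp
    simp only [Set.mem_union, not_or, Set.mem_ofPred_eq, not_exists, not_lt] at hp
    rw [Set.mem_compl_iff, not_not, Set.mem_ofPred_eq]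
    exact hp
  have hlin : ∀ e : ι → ℝ, ∑ i, e i ^ 2 = 1 → (gam s ι).real {x | ε < |∑ i, e i * x i|} ≤
      2 * Real.exp (-(ε ^ 2 / (2 * s))) := by
    intro e he
    refine le_trans (le_of_eq ?_) (gauss_abs s hs ε h0)
    exact (mp_fun1 s e he).measureReal_preimage (s := {x : ℝ | ε < |x|})
      (measurableSet_lt measurable_const (by fun_prop)).nullMeasurableSet
  have := coord_bad (ι := ι) s hs ε h0
  calc _ ≤ _ := measureReal_mono hsub
    _ ≤ _ := measureReal_union_le _ _
    _ ≤ _ := add_le_add this ((measureReal_union_le _ _).trans (add_le_add (hlin e he) (hlin f hf)))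
    _ ≤ _ := by linarith

/-- projections on one direction -/
def PJ {ι κ : Type*} [Fintype ι] [Fintype κ] (s : ℝ≥0) (ε : ℝ) (V : ι → κ → ℝ) (w : κ → ℝ) : Prop :=
  (∀ j, (∑ k, V j k * w k) ^ 2 ≤ ε ^ 2 * ∑ k, w k ^ 2) ∧
  |∑ j, (∑ k, V j k * w k) ^ 2 - (∑ k, w k ^ 2) * (Fintype.card ι * s)|
    ≤ ε * ((∑ k, w k ^ 2) * (Fintype.card ι * s))

lemma proj_bad {ι κ : Type*} [Fintype ι] [Fintype κ] (s : ℝ≥0) (hs : s ≠ 0) (ε : ℝ) (h0 : 0 ≤ ε)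
    (h1 : ε ≤ 1) (w : κ → ℝ) (hw : 0 < ∑ k, w k ^ 2) :
    (Measure.pi fun _ : ι => gam s κ).real {V | PJ s ε V w}ᶜ ≤
      Fintype.card ι * (2 * Real.exp (-(ε ^ 2 / (2 * s)))) +
        2 * Real.exp (-(Fintype.card ι * ε ^ 2 / 8)) := by
  set R := ∑ k, w k ^ 2 with hR
  have hr : √R ^ 2 = R := Real.sq_sqrt hw.le
  have hr0 : 0 < √R := Real.sqrt_pos.2 hw
  set r := √R
  have hu : ∑ k, (w k / r) ^ 2 = 1 := by
    simp_rw [div_pow, ← Finset.sum_div, hr]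
    exact div_self hw.ne'
  have hmp := mp_proj1 (ι := ι) s _ hu
  have hpre : ∀ (V : ι → κ → ℝ) j, ∑ k, V j k * w k = r * ∑ k, V j k * (w k / r) := by
    intro V j
    rw [Finset.mul_sum]
    exact Finset.sum_congr rfl fun k _ => by field_simp
  set T : ℝ := Fintype.card ι * s
  have hsub : {V : ι → κ → ℝ | PJ s ε V w}ᶜ ⊆
      (fun V : ι → κ → ℝ => (fun j => ∑ k, V j k * (w k / r))) ⁻¹'
        ({x | ∃ j, ε < |x j|} ∪ {x | ε * T < |∑ i, x i ^ 2 - T|}) := by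
    intro V
    contrapose!
    intro hp
    simp only [Set.mem_preimage, Set.mem_union, not_or, Set.mem_ofPred_eq, not_exists, not_lt] at hp
    rw [Set.mem_compl_iff, not_not, Set.mem_ofPred_eq, PJ]
    simp_rw [hpre V, mul_pow, ← Finset.mul_sum, ← hR, hr]
    constructor
    · intro j
      have h2 := hp.1 j
      rw [mul_comm]
      exact mul_le_mul_of_nonneg_right (sq_le_sq' (abs_le.1 h2).1 (abs_le.1 h2).2) hw.le
    · change |_ - R * T| ≤ ε * (R * T)
      rw [← mul_sub, abs_mul, abs_of_pos hw]
      have := mul_le_mul_of_nonneg_left hp.2 hw.le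
      linarith
  have hm : MeasurableSet ({x : ι → ℝ | ∃ j, ε < |x j|} ∪ {x | ε * T < |∑ i, x i ^ 2 - T|}) := by
    apply MeasurableSet.union
    · have : {x : ι → ℝ | ∃ j, ε < |x j|} = ⋃ j, {x | ε < |x j|} := by ext; simp
      rw [this]
      exact MeasurableSet.iUnion fun j => measurableSet_lt measurable_const (by fun_prop)
    · exact measurableSet_lt measurable_const (by fun_prop)
  calc _ ≤ _ := measureReal_mono hsub
    _ = _ := hmp.measureReal_preimage hm.nullMeasurableSet
    _ ≤ _ := measureReal_union_le _ _
    _ ≤ _ := add_le_add (coord_bad s hs ε h0) (chi2 s hs ε h0 h1)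

/-- good coefficient vectors -/
def GD {ι : Type*} [Fintype ι] [DecidableEq ι] (i0 i1 : ι) (T ε : ℝ) (a b : ι → ℝ) : Prop :=
  (∀ j, |a j - (Pi.single i0 1 : ι → ℝ) j| ≤ ε) ∧ (∀ j, |b j - (Pi.single i1 1 : ι → ℝ) j| ≤ ε) ∧
  |∑ j, a j ^ 2 - T| ≤ ε * T ∧ |∑ j, b j ^ 2 - T| ≤ ε * T ∧ |∑ j, a j * b j| ≤ ε * T

lemma measurable_GD {ι : Type*} [Fintype ι] [DecidableEq ι] (i0 i1 : ι) (T ε : ℝ) :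
    MeasurableSet {q : (ι → ℝ) × (ι → ℝ) | GD i0 i1 T ε q.1 q.2} := by
  have : {q : (ι → ℝ) × (ι → ℝ) | GD i0 i1 T ε q.1 q.2} =
    (⋂ j, {q | |q.1 j - (Pi.single i0 1 : ι → ℝ) j| ≤ ε}) ∩
    ((⋂ j, {q | |q.2 j - (Pi.single i1 1 : ι → ℝ) j| ≤ ε}) ∩
    ({q | |∑ j, q.1 j ^ 2 - T| ≤ ε * T} ∩ ({q | |∑ j, q.2 j ^ 2 - T| ≤ ε * T} ∩
      {q | |∑ j, q.1 j * q.2 j| ≤ ε * T}))) := by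
    ext q; simp [GD]
  rw [this]
  refine (MeasurableSet.iInter fun j => measurableSet_le (by fun_prop) (by fun_prop)).inter
    ((MeasurableSet.iInter fun j => measurableSet_le (by fun_prop) (by fun_prop)).inter
    ((measurableSet_le (by fun_prop) (by fun_prop)).inter
    ((measurableSet_le (by fun_prop) (by fun_prop)).inter
    (measurableSet_le (by fun_prop) (by fun_prop)))))

lemma sum_two {ι : Type*} [Fintype ι] [DecidableEq ι] (i0 i1 : ι) (hne : i0 ≠ i1) (F f : ι → ℝ)
    (h : ∀ k, k ≠ i0 ∧ k ≠ i1 → F k = f k) :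
    ∑ k, F k = ∑ k, f k - f i0 - f i1 + F i0 + F i1 := by
  have := Fintype.sum_eq_add (f := fun k => F k - f k) i0 i1 hne (fun k hk => by simp [h k hk])
  rw [Finset.sum_sub_distrib] at this
  linarith

lemma abs_mul_le' (p q c e : ℝ) (h1 : |p| ≤ c) (h2 : |q| ≤ e) : -(c * e) ≤ p * q ∧ p * q ≤ c * e := by
  rw [← abs_le, abs_mul]
  exact mul_le_mul h1 h2 (abs_nonneg _) ((abs_nonneg _).trans h1)

lemma V_scal1 (ε T Y X SA A0 A1 : ℝ) (h0 : 0 < ε) (h1 : ε ≤ 1 / 100) (hT0 : 0 < T) (hT : 1 ≤ ε * T)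
    (g1 : -ε ≤ Y - 1 ∧ Y - 1 ≤ ε) (hX : |X| ≤ ε) (y2 : |SA - Y * T| ≤ ε * (Y * T))
    (hA0 : |A0| ≤ 2 * ε) (hA1 : |A1| ≤ 2 * ε) :
    |SA - A0 ^ 2 - A1 ^ 2 + Y ^ 2 + X ^ 2 - T| ≤ 6 * ε * T := by
  have a0 := abs_mul_le' _ _ _ _ hA0 hA0
  have a1 := abs_mul_le' _ _ _ _ hA1 hA1
  have hee : ε * ε ≤ 1 / 10000 := by nlinarith
  have x0 := abs_mul_le' _ _ _ _ hX hX
  have y0 := abs_mul_le' Y Y 2 (101/100) (abs_le.2 ⟨by linarith, by linarith⟩)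
    (abs_le.2 ⟨by linarith, by linarith⟩)
  have yy : 0 ≤ Y * Y := mul_self_nonneg _
  have hεT : 0 < ε * T := by positivity
  have t1 := mul_le_mul_of_nonneg_right g1.1 hT0.le
  have t2 := mul_le_mul_of_nonneg_right g1.2 hT0.le
  have t3 := mul_le_mul_of_nonneg_right (show Y ≤ 101/100 by linarith) hεT.le
  rw [abs_le] at y2 ⊢
  constructor <;> nlinarith

lemma V_scal2 (ε T Y Z X SA SB SAB A0 A1 B0 B1 : ℝ) (h0 : 0 < ε) (h1 : ε ≤ 1 / 100) (hT0 : 0 < T)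
    (hT : 1 ≤ ε * T)
    (g1 : -ε ≤ Y - 1 ∧ Y - 1 ≤ ε) (g2 : -ε ≤ Z - 1 ∧ Z - 1 ≤ ε) (hX : |X| ≤ ε)
    (p2 : |SA + SB + 2 * SAB - (Y + Z + 2 * X) * T| ≤ ε * ((Y + Z + 2 * X) * T))
    (m2 : |SA + SB - 2 * SAB - (Y + Z - 2 * X) * T| ≤ ε * ((Y + Z - 2 * X) * T))
    (hA0 : |A0| ≤ 2 * ε) (hA1 : |A1| ≤ 2 * ε) (hB0 : |B0| ≤ 2 * ε) (hB1 : |B1| ≤ 2 * ε) :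
    |SAB - A0 * B0 - A1 * B1 + Y * X + X * Z| ≤ 6 * ε * T := by
  have a0 := abs_mul_le' _ _ _ _ hA0 hB0
  have a1 := abs_mul_le' _ _ _ _ hA1 hB1
  have hee : ε * ε ≤ 1 / 10000 := by nlinarith
  have y0 := abs_mul_le' Y X 2 ε (abs_le.2 ⟨by linarith, by linarith⟩) hX
  have z0 := abs_mul_le' X Z ε 2 hX (abs_le.2 ⟨by linarith, by linarith⟩)
  have hεT : 0 < ε * T := by positivity
  rw [abs_le] at hX
  have t1 := mul_le_mul_of_nonneg_right hX.1 hT0.le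
  have t2 := mul_le_mul_of_nonneg_right hX.2 hT0.le
  have t3 := mul_le_mul_of_nonneg_right (show Y + Z ≤ 203/100 by linarith) hεT.le
  rw [abs_le] at p2 m2 ⊢
  obtain ⟨p2, p3⟩ := p2
  obtain ⟨m2, m3⟩ := m2
  constructor <;> linarith

lemma V_det {ι κ : Type*} [Fintype ι] [DecidableEq ι] [Fintype κ] (i0 i1 : ι) (hne : i0 ≠ i1)
    (s : ℝ≥0) (ε : ℝ) (h0 : 0 < ε) (h1 : ε ≤ 1 / 100) (hT : 1 ≤ ε * (Fintype.card ι * s))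
    (V : ι → κ → ℝ) (y z : κ → ℝ) (hg : PG ε y z) (hy : PJ s ε V y) (hz : PJ s ε V z)
    (hp : PJ s ε V (fun k => y k + z k)) (hm : PJ s ε V (fun k => y k - z k))
    (a b : ι → ℝ) (a0 : a i0 = ∑ k, y k ^ 2) (a1 : a i1 = ∑ k, y k * z k)
    (b0 : b i0 = ∑ k, y k * z k) (b1 : b i1 = ∑ k, z k ^ 2)
    (ha : ∀ j, j ≠ i0 ∧ j ≠ i1 → a j = ∑ k, V j k * y k)
    (hb : ∀ j, j ≠ i0 ∧ j ≠ i1 → b j = ∑ k, V j k * z k) :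
    GD i0 i1 (Fintype.card ι * s) (6 * ε) a b := by
  obtain ⟨g1, g2, g3⟩ := hg
  obtain ⟨y1, y2⟩ := hy
  obtain ⟨z1, z2⟩ := hz
  obtain ⟨-, p2⟩ := hp
  obtain ⟨-, m2⟩ := hm
  set T : ℝ := Fintype.card ι * s
  have hp' : ∀ j, ∑ k, V j k * (y k + z k) = ∑ k, V j k * y k + ∑ k, V j k * z k := by
    intro j; simp only [mul_add, Finset.sum_add_distrib]
  have hm' : ∀ j, ∑ k, V j k * (y k - z k) = ∑ k, V j k * y k - ∑ k, V j k * z k := by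
    intro j; simp only [mul_sub, Finset.sum_sub_distrib]
  simp only [hp'] at p2
  simp only [hm'] at m2
  set A : ι → ℝ := fun j => ∑ k, V j k * y k with hA
  set B : ι → ℝ := fun j => ∑ k, V j k * z k with hB
  change |∑ j, A j ^ 2 - _| ≤ _ at y2
  change |∑ j, B j ^ 2 - _| ≤ _ at z2
  change |∑ j, (A j + B j) ^ 2 - _| ≤ _ at p2
  change |∑ j, (A j - B j) ^ 2 - _| ≤ _ at m2
  have eP : ∑ j, (A j + B j) ^ 2 = ∑ j, A j ^ 2 + ∑ j, B j ^ 2 + 2 * ∑ j, A j * B j := by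
    simp only [Finset.mul_sum, ← Finset.sum_add_distrib]
    exact Finset.sum_congr rfl fun i _ => by ring
  have eM : ∑ j, (A j - B j) ^ 2 = ∑ j, A j ^ 2 + ∑ j, B j ^ 2 - 2 * ∑ j, A j * B j := by
    simp only [Finset.mul_sum, ← Finset.sum_add_distrib, ← Finset.sum_sub_distrib]
    exact Finset.sum_congr rfl fun i _ => by ring
  have eP' : ∑ j, (y j + z j) ^ 2 = ∑ j, y j ^ 2 + ∑ j, z j ^ 2 + 2 * ∑ j, y j * z j := by
    simp only [Finset.mul_sum, ← Finset.sum_add_distrib]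
    exact Finset.sum_congr rfl fun i _ => by ring
  have eM' : ∑ j, (y j - z j) ^ 2 = ∑ j, y j ^ 2 + ∑ j, z j ^ 2 - 2 * ∑ j, y j * z j := by
    simp only [Finset.mul_sum, ← Finset.sum_add_distrib, ← Finset.sum_sub_distrib]
    exact Finset.sum_congr rfl fun i _ => by ring
  rw [eP, eP'] at p2
  rw [eM, eM'] at m2
  have sa : ∑ j, a j ^ 2 = ∑ j, A j ^ 2 - A i0 ^ 2 - A i1 ^ 2 + a i0 ^ 2 + a i1 ^ 2 :=
    sum_two i0 i1 hne _ _ (fun k hk => by rw [ha k hk])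
  have sb : ∑ j, b j ^ 2 = ∑ j, B j ^ 2 - B i0 ^ 2 - B i1 ^ 2 + b i0 ^ 2 + b i1 ^ 2 :=
    sum_two i0 i1 hne _ _ (fun k hk => by rw [hb k hk])
  have sab : ∑ j, a j * b j = ∑ j, A j * B j - A i0 * B i0 - A i1 * B i1 + a i0 * b i0 + a i1 * b i1 :=
    sum_two i0 i1 hne _ _ (fun k hk => by rw [ha k hk, hb k hk])
  set Y := ∑ k, y k ^ 2
  set Z := ∑ k, z k ^ 2
  set X := ∑ k, y k * z k
  have hT0 : 0 < T := by by_contra h; push Not at h; nlinarith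
  rw [abs_le] at g1 g2
  have hX2 : |X| ≤ ε := g3
  have hAb : ∀ j, |A j| ≤ 2 * ε := by
    intro j
    apply abs_le_of_sq_le_sq _ (by positivity)
    calc _ ≤ _ := y1 j
      _ ≤ _ := by rw [mul_pow, mul_comm]; gcongr; linarith
  have hBb : ∀ j, |B j| ≤ 2 * ε := by
    intro j
    apply abs_le_of_sq_le_sq _ (by positivity)
    calc _ ≤ _ := z1 j
      _ ≤ _ := by rw [mul_pow, mul_comm]; gcongr; linarith
  refine ⟨?_, ?_, ?_, ?_, ?_⟩
  · intro j
    by_cases j0 : j = i0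
    · subst j0
      rw [a0, Pi.single_eq_same, abs_le]; constructor <;> linarith
    · rw [Pi.single_eq_of_ne j0, sub_zero]
      by_cases j1 : j = i1
      · subst j1
        rw [a1]; linarith
      · rw [ha j ⟨j0, j1⟩]; linarith [hAb j]
  · intro j
    by_cases j0 : j = i1
    · subst j0
      rw [b1, Pi.single_eq_same, abs_le]; constructor <;> linarith
    · rw [Pi.single_eq_of_ne j0, sub_zero]
      by_cases j1 : j = i0
      · subst j1
        rw [b0]; linarith
      · rw [hb j ⟨j1, j0⟩]; linarith [hBb j]
  · rw [sa, a0, a1]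
    exact V_scal1 ε T Y X _ _ _ h0 h1 hT0 hT g1 hX2 y2 (hAb i0) (hAb i1)
  · rw [sb, b0, b1, add_right_comm]
    exact V_scal1 ε T Z X _ _ _ h0 h1 hT0 hT g2 hX2 z2 (hBb i0) (hBb i1)
  · rw [sab, a0, a1, b0, b1]
    exact V_scal2 ε T Y Z X _ _ _ _ _ _ _ h0 h1 hT0 hT g1 g2 hX2 p2 m2 (hAb i0) (hAb i1) (hBb i0)
      (hBb i1)

lemma V_bad {ι κ : Type*} [Fintype ι] [DecidableEq ι] [Fintype κ] (i0 i1 : ι) (hne : i0 ≠ i1)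
    (s : ℝ≥0) (hs : (Fintype.card κ : ℝ) * s = 1) (ε : ℝ) (h0 : 0 < ε) (h1 : ε ≤ 1 / 100)
    (hT : 1 ≤ ε * (Fintype.card ι * s)) (hcard : Fintype.card κ ≤ Fintype.card ι) :
    (Measure.pi fun _ : ι => gam s κ).real
      {V | GD i0 i1 (Fintype.card ι * s) (6 * ε) (fun j => ∑ k, V j k * V i0 k)
        (fun j => ∑ k, V j k * V i1 k)}ᶜ ≤
      24 * Fintype.card ι * Real.exp (-(Fintype.card κ * ε ^ 2 / 8)) := by
  have hs0 : s ≠ 0 := by rintro rfl; simp at hs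
  have hs0' : (0:ℝ) < s := by positivity
  set N : ℝ := ((Fintype.card ι : ℕ) : ℝ)
  set D : ℝ := ((Fintype.card κ : ℕ) : ℝ)
  have hDN : D ≤ N := Nat.cast_le.2 hcard
  have hmp := mp_resamp (ι := ι) (κ := κ) s (Pi.single i0 1) (Pi.single i1 1)
    (by simp [Pi.single_apply]) (by simp [Pi.single_apply]) (by simp [Pi.single_apply, hne.symm])
  set E := {V : ι → κ → ℝ | GD i0 i1 (N * s) (6 * ε) (fun j => ∑ k, V j k * V i0 k)
        (fun j => ∑ k, V j k * V i1 k)}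
  have hE : MeasurableSet E := by
    have : Measurable (fun V : ι → κ → ℝ => ((fun j => ∑ k, V j k * V i0 k),
      (fun j => ∑ k, V j k * V i1 k))) := by fun_prop
    exact this (measurable_GD i0 i1 (N * s) (6 * ε))
  rw [← hmp.measureReal_preimage hE.compl.nullMeasurableSet]
  have hN1 : 1 ≤ N := by
    have : 0 < Fintype.card ι := Fintype.card_pos_iff.2 ⟨i0⟩
    exact Nat.one_le_cast.2 this
  have e1 : Real.exp (-(ε ^ 2 / (2 * s))) ≤ Real.exp (-(D * ε ^ 2 / 8)) := by
    apply Real.exp_le_exp.2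
    have : D = 1 / s := by field_simp; linarith
    rw [this]
    apply neg_le_neg
    rw [one_div_mul_eq_div, div_div, div_le_div_iff₀ (by positivity) (by positivity)]
    nlinarith [mul_pos (pow_pos h0 2) hs0']
  have e2 : Real.exp (-(N * ε ^ 2 / 8)) ≤ Real.exp (-(D * ε ^ 2 / 8)) := by
    apply Real.exp_le_exp.2
    gcongr
  set X := Real.exp (-(D * ε ^ 2 / 8)) with hX
  have hX0 : 0 < X := Real.exp_pos _
  have hfib : ∀ q ∈ {p : (κ → ℝ) × (κ → ℝ) | PG ε p.1 p.2}, (Measure.pi fun _ : ι => gam s κ).real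
      {V | (V, q) ∈ resamp (Pi.single i0 1) (Pi.single i1 1) ⁻¹' Eᶜ} ≤ 8 * N * X + 8 * X := by
    rintro ⟨y, z⟩ hyz
    have hPG : PG ε y z := hyz
    obtain ⟨g1, g2, g3⟩ := hyz
    simp only [abs_le] at g1 g2 g3
    have hYp : 0 < ∑ k, y k ^ 2 := by linarith
    have hZp : 0 < ∑ k, z k ^ 2 := by linarith
    have eP' : ∑ j, (y j + z j) ^ 2 = ∑ j, y j ^ 2 + ∑ j, z j ^ 2 + 2 * ∑ j, y j * z j := by
      simp only [Finset.mul_sum, ← Finset.sum_add_distrib]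
      exact Finset.sum_congr rfl fun i _ => by ring
    have eM' : ∑ j, (y j - z j) ^ 2 = ∑ j, y j ^ 2 + ∑ j, z j ^ 2 - 2 * ∑ j, y j * z j := by
      simp only [Finset.mul_sum, ← Finset.sum_add_distrib, ← Finset.sum_sub_distrib]
      exact Finset.sum_congr rfl fun i _ => by ring
    have b1 := proj_bad (ι := ι) s hs0 ε h0.le (by linarith) y hYp
    have b2 := proj_bad (ι := ι) s hs0 ε h0.le (by linarith) z hZp
    have b3 := proj_bad (ι := ι) s hs0 ε h0.le (by linarith) (fun k => y k + z k)
      (by rw [eP']; linarith)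
    have b4 := proj_bad (ι := ι) s hs0 ε h0.le (by linarith) (fun k => y k - z k)
      (by rw [eM']; linarith)
    have hb : N * (2 * Real.exp (-(ε ^ 2 / (2 * s)))) + 2 * Real.exp (-(N * ε ^ 2 / 8))
        ≤ 2 * N * X + 2 * X := by nlinarith
    have hsub : {V | (V, (y, z)) ∈ resamp (Pi.single i0 1) (Pi.single i1 1) ⁻¹' Eᶜ} ⊆
        ({V : ι → κ → ℝ | PJ s ε V y}ᶜ ∪ {V | PJ s ε V z}ᶜ) ∪
        ({V | PJ s ε V (fun k => y k + z k)}ᶜ ∪ {V | PJ s ε V (fun k => y k - z k)}ᶜ) := by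
      intro V
      contrapose!
      intro hp
      simp only [Set.mem_union, not_or, Set.mem_compl_iff, not_not, Set.mem_ofPred_eq] at hp
      obtain ⟨⟨q1, q2⟩, q3, q4⟩ := hp
      have r0 : ∀ k, resamp (Pi.single i0 1) (Pi.single i1 1) (V, y, z) i0 k = y k := by
        intro k; simp [resamp, Pi.single_apply, hne, hne.symm]
      have r1 : ∀ k, resamp (Pi.single i0 1) (Pi.single i1 1) (V, y, z) i1 k = z k := by
        intro k; simp [resamp, Pi.single_apply, hne, hne.symm]
      have r2 : ∀ j k, j ≠ i0 ∧ j ≠ i1 →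
          resamp (Pi.single i0 1) (Pi.single i1 1) (V, y, z) j k = V j k := by
        intro j k h; simp [resamp, Pi.single_apply, h.1, h.2]
      simp only [Set.mem_ofPred_eq, Set.mem_preimage, Set.mem_compl_iff, not_not]
      show GD i0 i1 (N * s) (6 * ε) _ _
      simp only [r0, r1]
      refine V_det i0 i1 hne s ε h0 h1 hT V y z hPG q1 q2 q3 q4 _ _ ?_ ?_ ?_ ?_ ?_ ?_
      · simp only [r0, sq]
      · simp only [r1]; exact Finset.sum_congr rfl fun k _ => mul_comm _ _
      · simp only [r0]
      · simp only [r1, sq]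
      · intro j hj; simp only [r2 j _ hj]
      · intro j hj; simp only [r2 j _ hj]
    calc _ ≤ _ := measureReal_mono hsub
      _ ≤ _ := measureReal_union_le _ _
      _ ≤ _ := add_le_add (measureReal_union_le _ _) (measureReal_union_le _ _)
      _ ≤ _ := by linarith
  have key := fub _ _ _ (hmp.measurable hE.compl) {p | PG ε p.1 p.2} (8 * X) (8 * N * X + 8 * X)
    (pair_bad s hs ε h0.le (by linarith)) (by positivity) hfib
  refine key.trans ?_
  nlinarith

lemma sqrt_near (r t η : ℝ) (hr : 0 ≤ r) (ht : 0 < t) (h : |r ^ 2 - t ^ 2| ≤ η * t ^ 2) :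
    |r - t| ≤ η * t := by
  have h1 : |r - t| * (r + t) ≤ η * t * t := by
    have : r ^ 2 - t ^ 2 = (r - t) * (r + t) := by ring
    rw [this, abs_mul, abs_of_nonneg (by linarith : 0 ≤ r + t)] at h
    linarith
  have h2 : |r - t| * t ≤ |r - t| * (r + t) := by
    apply mul_le_mul_of_nonneg_left _ (abs_nonneg _); linarith
  exact le_of_mul_le_mul_right (h2.trans h1) ht

/-- Gram-Schmidt with quantitative control -/
lemma gs {κ : Type*} [Fintype κ] (y z : κ → ℝ) (t η : ℝ) (ht : 0 < t) (h0 : 0 < η)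
    (h1 : η ≤ 1 / 100) (hy : |∑ k, y k ^ 2 - t ^ 2| ≤ η * t ^ 2)
    (hz : |∑ k, z k ^ 2 - t ^ 2| ≤ η * t ^ 2) (hyz : |∑ k, y k * z k| ≤ η * t ^ 2) :
    ∃ (f1 f2 : κ → ℝ) (r1 r2 r3 : ℝ), 0 < r1 ∧ 0 < r3 ∧ |r1 - t| ≤ η * t ∧ |r2| ≤ 2 * η * t ∧
      |r3 - t| ≤ 2 * η * t ∧ ∑ k, f1 k ^ 2 = 1 ∧ ∑ k, f2 k ^ 2 = 1 ∧ ∑ k, f1 k * f2 k = 0 ∧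
      (∀ k, y k = r1 * f1 k) ∧ (∀ k, z k = r2 * f1 k + r3 * f2 k) := by
  set P := ∑ k, y k ^ 2 with hP
  set Q := ∑ k, z k ^ 2 with hQ
  set R := ∑ k, y k * z k with hR
  have ht2 : 0 < t ^ 2 := by positivity
  have hy' := abs_le.1 hy
  have hz' := abs_le.1 hz
  have hP0 : t ^ 2 / 2 < P := by nlinarith
  have hPp : 0 < P := by linarith
  have hr1 : √P ^ 2 = P := Real.sq_sqrt hPp.le
  have hr1p : 0 < √P := Real.sqrt_pos.2 hPp
  set r1 := √P
  have hn1 := sqrt_near r1 t η hr1p.le ht (by rw [hr1]; exact hy)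
  have hn1' := abs_le.1 hn1
  have hr1b : t / 2 < r1 := by nlinarith
  set r2 := R / r1 with hr2
  have hr2' : r2 * r1 = R := by rw [hr2]; field_simp
  have hr2b : |r2| ≤ 2 * η * t := by
    rw [hr2, abs_div, abs_of_pos hr1p, div_le_iff₀ hr1p]
    refine hyz.trans ?_
    have := mul_le_mul_of_nonneg_left hr1b.le (show 0 ≤ 2 * η * t by positivity)
    linarith
  have hr22 : r2 ^ 2 ≤ η * t ^ 2 := by
    have := abs_mul_le' _ _ _ _ hr2b hr2b
    have h3 : η * (η * t ^ 2) ≤ 1 / 100 * (η * t ^ 2) := by gcongr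
    nlinarith [mul_pos h0 ht2]
  have hQ' : |Q - r2 ^ 2 - t ^ 2| ≤ 2 * η * t ^ 2 := by
    rw [abs_le]; constructor <;> nlinarith [sq_nonneg r2]
  have hQ'' := abs_le.1 hQ'
  have hQp : 0 < Q - r2 ^ 2 := by nlinarith
  have hr3 : √(Q - r2 ^ 2) ^ 2 = Q - r2 ^ 2 := Real.sq_sqrt hQp.le
  have hr3p : 0 < √(Q - r2 ^ 2) := Real.sqrt_pos.2 hQp
  set r3 := √(Q - r2 ^ 2)
  have hn3 := sqrt_near r3 t (2 * η) hr3p.le ht (by rw [hr3]; exact hQ')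
  have s1 : ∑ k, (y k / r1) ^ 2 = 1 := by
    simp_rw [div_pow, ← Finset.sum_div, hr1]
    exact div_self hPp.ne'
  have s2 : ∑ k, (y k / r1) * z k = r2 := by
    simp_rw [div_mul_eq_mul_div, ← Finset.sum_div]; rfl
  refine ⟨fun k => y k / r1, fun k => (z k - r2 * (y k / r1)) / r3, r1, r2, r3, hr1p, hr3p, hn1,
    hr2b, hn3, s1, ?_, ?_, ?_, ?_⟩
  · simp_rw [div_pow _ r3, ← Finset.sum_div, hr3]
    rw [div_eq_one_iff_eq hQp.ne']
    have : ∀ k, (z k - r2 * (y k / r1)) ^ 2 = z k ^ 2 - 2 * r2 * (y k / r1 * z k)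
      + r2 ^ 2 * (y k / r1) ^ 2 := by intro k; ring
    simp_rw [this, Finset.sum_add_distrib, Finset.sum_sub_distrib, ← Finset.mul_sum, s1, s2]
    ring
  · have : ∀ k, y k / r1 * ((z k - r2 * (y k / r1)) / r3) =
      (1 / r3) * (y k / r1 * z k) - (r2 / r3) * (y k / r1) ^ 2 := by intro k; ring
    simp_rw [this, Finset.sum_sub_distrib, ← Finset.mul_sum, s1, s2]
    ring
  · intro k; field_simp
  · intro k; field_simp; ring

lemma resamp_dot {ι κ : Type*} [Fintype ι] [Fintype κ] (e f : ι → ℝ) (U : ι → κ → ℝ) (G H w : κ → ℝ)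
    (j : ι) : ∑ l, resamp e f (U, G, H) j l * w l =
      (∑ l, U j l * w l) - e j * (∑ i, e i * ∑ l, U i l * w l) - f j * (∑ i, f i * ∑ l, U i l * w l)
        + e j * (∑ l, G l * w l) + f j * (∑ l, H l * w l) := by
  have h : ∀ e : ι → ℝ, ∑ i, e i * ∑ l, U i l * w l = ∑ l, (∑ i, e i * U i l) * w l := by
    intro e
    simp_rw [Finset.mul_sum, Finset.sum_mul]
    rw [Finset.sum_comm]
    exact Finset.sum_congr rfl fun _ _ => Finset.sum_congr rfl fun _ _ => by ring
  simp_rw [h]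
  obtain ⟨p, hp⟩ : ∃ p : (ι → ℝ) → κ → ℝ, ∀ e l, ∑ i, e i * U i l = p e l := ⟨_, fun _ _ => rfl⟩
  simp_rw [resamp, hp, Finset.mul_sum, ← Finset.sum_sub_distrib, ← Finset.sum_add_distrib]
  exact Finset.sum_congr rfl fun _ _ => by ring

lemma resamp_comb {ι κ : Type*} [Fintype ι] [Fintype κ] (e f : ι → ℝ) (U : ι → κ → ℝ) (G H : κ → ℝ)
    (he : ∑ i, e i ^ 2 = 1) (hef : ∑ i, e i * f i = 0)
    (l : κ) : ∑ i, e i * resamp e f (U, G, H) i l = G l := by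
  have : ∀ i, e i * resamp e f (U, G, H) i l = e i * U i l - (e i ^ 2) * (∑ i, e i * U i l)
      - (e i * f i) * (∑ i, f i * U i l) + (e i ^ 2) * G l + (e i * f i) * H l := by
    intro i; simp only [resamp]; ring
  simp_rw [this, Finset.sum_add_distrib, Finset.sum_sub_distrib, ← Finset.sum_mul, he, hef]
  ring

lemma resamp_comb' {ι κ : Type*} [Fintype ι] [Fintype κ] (e f : ι → ℝ) (U : ι → κ → ℝ) (G H : κ → ℝ)
    (hf : ∑ i, f i ^ 2 = 1) (hef : ∑ i, e i * f i = 0)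
    (l : κ) : ∑ i, f i * resamp e f (U, G, H) i l = H l := by
  have : ∀ i, f i * resamp e f (U, G, H) i l = f i * U i l - (e i * f i) * (∑ i, e i * U i l)
      - (f i ^ 2) * (∑ i, f i * U i l) + (e i * f i) * G l + (f i ^ 2) * H l := by
    intro i; simp only [resamp]; ring
  simp_rw [this, Finset.sum_add_distrib, Finset.sum_sub_distrib, ← Finset.sum_mul, hf, hef]
  ring

/-- score column -/
def Sc {ι κ : Type*} [Fintype ι] [Fintype κ] (U : ι → κ → ℝ) (a : ι → ℝ) (j : ι) : ℝ :=
  ∑ k, a k * ∑ l, U j l * U k l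

lemma Sc_eq {ι κ : Type*} [Fintype ι] [Fintype κ] (U : ι → κ → ℝ) (a : ι → ℝ) (j : ι) :
    Sc U a j = ∑ l, U j l * ∑ k, a k * U k l := by
  simp_rw [Sc, Finset.mul_sum]
  rw [Finset.sum_comm]
  exact Finset.sum_congr rfl fun _ _ => Finset.sum_congr rfl fun _ _ => by ring

lemma col_scal (η τ t X x a b M M' g c ρ δ : ℝ) (h0 : 0 < η) (h1 : η ≤ 1 / 100) (hτ : 0 < τ)
    (ht : |t - τ| ≤ 2 * η * τ) (hX : |X - x| ≤ 4 * η ^ 2) (hx : |x| ≤ η) (ha : |a - δ| ≤ 5 * η)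
    (hδ : |δ| ≤ 1) (hb : |b| ≤ 2) (hρ : |ρ| ≤ 2) (hM : |M| ≤ 4 * η) (hM' : |M'| ≤ 4 * η)
    (hg : |g - 1| ≤ η) (hc : |c| ≤ η) :
    |t * X - a * M - ρ * b * M' + a * g + ρ * b * c - (δ + τ * x)| ≤ 50 * (η + τ * η ^ 2) := by
  have hητ : 0 < η * τ := by positivity
  have ht2 : |t| ≤ 2 * τ := by
    rw [abs_le] at ht ⊢
    have : η * τ ≤ 1 / 100 * τ := by gcongr
    constructor <;> linarith
  have ha2 : |a| ≤ 2 := by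
    rw [abs_le] at ha hδ ⊢
    constructor <;> linarith
  have k1 := abs_mul_le' _ _ _ _ ht2 hX
  have k2 := abs_mul_le' _ _ _ _ ht hx
  have k3 := abs_mul_le' _ _ _ _ ha2 hM
  have hρb := abs_le.2 (abs_mul_le' _ _ _ _ hρ hb)
  have k4 := abs_mul_le' _ _ _ _ hρb hM'
  have k5 := abs_mul_le' _ _ _ _ ha2 hg
  have k6 := abs_mul_le' _ _ _ _ hρb hc
  have hp : 0 < τ * η ^ 2 := by positivity
  rw [abs_le] at ha ⊢
  constructor <;> linarith

lemma add_scal (η τ S1 S2 k δ0 δ1 x1 x2 : ℝ) (h0 : 0 < η) (h1 : η ≤ 1 / 100) (hτ : 0 < τ)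
    (hS1 : |S1 - (δ0 + τ * x1)| ≤ 50 * (η + τ * η ^ 2))
    (hS2 : |S2 - (δ1 + τ * x2)| ≤ 50 * (η + τ * η ^ 2))
    (hδ : |δ0| ≤ 1) (hx : |x1| ≤ η) (hk : |k| ≤ 3 * η) :
    |S2 + k * S1 - (δ1 + τ * x2)| ≤ 60 * (η + τ * η ^ 2) := by
  have hp : 0 < τ * η ^ 2 := by positivity
  have hx' := abs_mul_le' τ x1 τ η (by rw [abs_of_pos hτ]) hx
  have hb : |S1| ≤ 1 + τ * η + 50 * (η + τ * η ^ 2) := by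
    rw [abs_le] at hS1 hδ ⊢
    constructor <;> linarith
  have := abs_mul_le' _ _ _ _ hk hb
  have e1 : η * η ≤ 1 / 100 * η := by gcongr
  have e2 : η * (τ * η ^ 2) ≤ 1 / 100 * (τ * η ^ 2) := by gcongr
  rw [abs_le] at hS2 ⊢
  constructor <;> nlinarith

set_option maxHeartbeats 1000000 in
lemma U_det {ι κ : Type*} [Fintype ι] [Fintype κ] (η τ : ℝ) (h0 : 0 < η) (h1 : η ≤ 1 / 100)
    (hτ : 0 < τ) (a b δ0 δ1 e1 e2 : ι → ℝ) (α k β : ℝ) (hα : 0 < α) (hβ : 0 < β)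
    (hατ : |α - τ| ≤ η * τ) (hkτ : |k| ≤ 2 * η * τ) (hβτ : |β - τ| ≤ 2 * η * τ)
    (he1 : ∑ i, e1 i ^ 2 = 1) (he2 : ∑ i, e2 i ^ 2 = 1) (he12 : ∑ i, e1 i * e2 i = 0)
    (ha : ∀ i, a i = α * e1 i) (hb : ∀ i, b i = k * e1 i + β * e2 i)
    (had : ∀ i, |a i - δ0 i| ≤ η) (hbd : ∀ i, |b i - δ1 i| ≤ η) (hδ0 : ∀ i, |δ0 i| ≤ 1)
    (hδ1 : ∀ i, |δ1 i| ≤ 1)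
    (G H f1 f2 : κ → ℝ) (r1 r2 r3 : ℝ) (hr1 : |r1 - 1| ≤ η) (hr2 : |r2| ≤ 2 * η)
    (hr3 : |r3 - 1| ≤ 2 * η) (hG : ∀ l, G l = r1 * f1 l) (hH : ∀ l, H l = r2 * f1 l + r3 * f2 l)
    (hGH : PG η G H) (U : ι → κ → ℝ) (x1 x2 : ι → ℝ) (hx1 : ∀ j, x1 j = ∑ l, U j l * f1 l)
    (hx2 : ∀ j, x2 j = ∑ l, U j l * f2 l)
    (c1 : (∀ j, |x1 j| ≤ η) ∧ |∑ i, e1 i * x1 i| ≤ η ∧ |∑ i, e2 i * x1 i| ≤ η)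
    (c2 : (∀ j, |x2 j| ≤ η) ∧ |∑ i, e1 i * x2 i| ≤ η ∧ |∑ i, e2 i * x2 i| ≤ η) (j : ι) :
    |Sc (resamp e1 e2 (U, G, H)) a j - (δ0 j + τ * x1 j)| ≤ 60 * (η + τ * η ^ 2) ∧
    |Sc (resamp e1 e2 (U, G, H)) b j - (δ1 j + τ * x2 j)| ≤ 60 * (η + τ * η ^ 2) := by
  obtain ⟨c10, c11, c12⟩ := c1
  obtain ⟨c20, c21, c22⟩ := c2
  obtain ⟨g1, g2, g3⟩ := hGH
  have hητ : η * τ ≤ 1 / 100 * τ := by gcongr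
  have hητ0 : 0 < η * τ := by positivity
  have hηη0 : 0 < η ^ 2 := by positivity
  have hηητ0 : 0 < τ * η ^ 2 := by positivity
  have hατ' := abs_le.1 hατ
  have hβτ' := abs_le.1 hβτ
  have sa : ∀ l, ∑ i, a i * resamp e1 e2 (U, G, H) i l = α * G l := by
    intro l
    rw [← resamp_comb e1 e2 U G H he1 he12 l, Finset.mul_sum]
    exact Finset.sum_congr rfl fun i _ => by rw [ha]; ring
  have sb : ∀ l, ∑ i, b i * resamp e1 e2 (U, G, H) i l = k * G l + β * H l := by
    intro l
    conv_rhs => rw [← resamp_comb e1 e2 U G H he1 he12 l, ← resamp_comb' e1 e2 U G H he2 he12 l,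
      Finset.mul_sum, Finset.mul_sum, ← Finset.sum_add_distrib]
    exact Finset.sum_congr rfl fun i _ => by rw [hb]; ring
  have UG : ∀ i, ∑ l, U i l * G l = r1 * x1 i := by
    intro i; rw [hx1, Finset.mul_sum]
    exact Finset.sum_congr rfl fun l _ => by rw [hG]; ring
  have UH : ∀ i, ∑ l, U i l * H l = r2 * x1 i + r3 * x2 i := by
    intro i; rw [hx1, hx2, Finset.mul_sum, Finset.mul_sum, ← Finset.sum_add_distrib]
    exact Finset.sum_congr rfl fun l _ => by rw [hH]; ring
  have eX : ∀ (e x : ι → ℝ) (r : ℝ), ∑ i, e i * (r * x i) = r * ∑ i, e i * x i := by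
    intro e x r; rw [Finset.mul_sum]; exact Finset.sum_congr rfl fun i _ => by ring
  have d1 := resamp_dot e1 e2 U G H G j
  have d2 := resamp_dot e1 e2 U G H H j
  simp only [UG, eX] at d1
  simp only [UH, mul_add, Finset.sum_add_distrib, eX] at d2
  have HG : ∑ l, H l * G l = ∑ l, G l * H l := Finset.sum_congr rfl fun l _ => mul_comm _ _
  rw [HG] at d1
  simp only [← sq] at d1 d2
  have S1 : Sc (resamp e1 e2 (U, G, H)) a j = α * ∑ l, resamp e1 e2 (U, G, H) j l * G l := by
    rw [Sc_eq, Finset.mul_sum]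
    exact Finset.sum_congr rfl fun l _ => by rw [sa]; ring
  have S2 : Sc (resamp e1 e2 (U, G, H)) b j = β * (∑ l, resamp e1 e2 (U, G, H) j l * H l)
      + k / α * Sc (resamp e1 e2 (U, G, H)) a j := by
    rw [S1, Sc_eq, ← mul_assoc, div_mul_cancel₀ _ hα.ne', Finset.mul_sum, Finset.mul_sum,
      ← Finset.sum_add_distrib]
    exact Finset.sum_congr rfl fun l _ => by rw [sb]; ring
  set p1 := ∑ i, e1 i * x1 i
  set p2 := ∑ i, e2 i * x1 i
  set q1 := ∑ i, e1 i * x2 i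
  set q2 := ∑ i, e2 i * x2 i
  have hr1' : |r1| ≤ 2 := by
    rw [abs_le] at hr1 ⊢; constructor <;> linarith
  have hr3' : |r3| ≤ 2 := by
    rw [abs_le] at hr3 ⊢; constructor <;> linarith
  have hr2' : |r2| ≤ 2 := by linarith
  have m1 : ∀ p, |p| ≤ η → |r1 * p| ≤ 4 * η := by
    intro p hp
    have := abs_le.2 (abs_mul_le' _ _ _ _ hr1' hp); linarith
  have m2 : ∀ p q, |p| ≤ η → |q| ≤ η → |r2 * p + r3 * q| ≤ 4 * η := by
    intro p q hp hq
    have h1 := (abs_mul_le' _ _ _ _ hr2' hp)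
    have h2 := (abs_mul_le' _ _ _ _ hr3' hq)
    rw [abs_le]; constructor <;> linarith
  have hkα : |k / α| ≤ 3 * η := by
    rw [abs_div, abs_of_pos hα, div_le_iff₀ hα]
    have := mul_le_mul_of_nonneg_left (show 99 / 100 * τ ≤ α by linarith) h0.le
    linarith
  have haj : |a j| ≤ 1 + η := by
    have h1 := abs_le.1 (had j); have h2 := abs_le.1 (hδ0 j)
    rw [abs_le]; constructor <;> linarith
  have hb'eq : β * e2 j = b j - k / α * a j := by
    rw [hb, ha, ← mul_assoc, div_mul_cancel₀ _ hα.ne']; ring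
  have hka := abs_mul_le' _ _ _ _ hkα haj
  have hηη : η * η ≤ 1 / 100 * η := by gcongr
  have hb'd : |β * e2 j - δ1 j| ≤ 5 * η := by
    have h1 := abs_le.1 (hbd j)
    rw [hb'eq, abs_le]; constructor <;> linarith
  have hb'2 : |β * e2 j| ≤ 2 := by
    have h1 := abs_le.1 hb'd; have h2 := abs_le.1 (hδ1 j)
    rw [abs_le]; constructor <;> linarith
  have ρ1 : |α / β| ≤ 2 := by
    rw [abs_of_pos (by positivity), div_le_iff₀ hβ]; linarith
  have ρ2 : |β / α| ≤ 2 := by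
    rw [abs_of_pos (by positivity), div_le_iff₀ hα]; linarith
  have X1 : |r1 * x1 j - x1 j| ≤ 4 * η ^ 2 := by
    have := abs_mul_le' _ _ _ _ hr1 (c10 j)
    rw [abs_le]; constructor <;> linarith
  have X2 : |r2 * x1 j + r3 * x2 j - x2 j| ≤ 4 * η ^ 2 := by
    have h1 := abs_mul_le' _ _ _ _ hr2 (c10 j)
    have h2 := abs_mul_le' _ _ _ _ hr3 (c20 j)
    rw [abs_le]; constructor <;> linarith
  have C1 := col_scal η τ α (r1 * x1 j) (x1 j) (a j) (β * e2 j) (r1 * p1) (r1 * p2) (∑ l, G l ^ 2)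
    (∑ l, G l * H l) (α / β) (δ0 j) h0 h1 hτ (hατ.trans (by linarith)) X1 (c10 j)
    ((had j).trans (by linarith)) (hδ0 j) hb'2 ρ1 (m1 _ c11) (m1 _ c12) g1 g3
  have C2 := col_scal η τ β (r2 * x1 j + r3 * x2 j) (x2 j) (β * e2 j) (a j) (r2 * p2 + r3 * q2)
    (r2 * p1 + r3 * q1) (∑ l, H l ^ 2)
    (∑ l, G l * H l) (β / α) (δ1 j) h0 h1 hτ hβτ X2 (c20 j)
    hb'd (hδ1 j) (haj.trans (by linarith)) ρ2 (m2 _ _ c12 c22) (m2 _ _ c11 c21) g2 g3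
  have S1' : Sc (resamp e1 e2 (U, G, H)) a j = α * (r1 * x1 j) - a j * (r1 * p1)
      - α / β * (β * e2 j) * (r1 * p2) + a j * (∑ l, G l ^ 2) + α / β * (β * e2 j) * ∑ l, G l * H l := by
    rw [S1, d1, ha]; field_simp
  have S2' : β * (∑ l, resamp e1 e2 (U, G, H) j l * H l) = β * (r2 * x1 j + r3 * x2 j)
      - β * e2 j * (r2 * p2 + r3 * q2)
      - β / α * a j * (r2 * p1 + r3 * q1) + β * e2 j * (∑ l, H l ^ 2)
      + β / α * a j * ∑ l, G l * H l := by
    rw [d2, ha]; field_simp; ring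
  rw [← S1'] at C1
  rw [← S2'] at C2
  refine ⟨C1.trans (by linarith), ?_⟩
  rw [S2]
  exact add_scal η τ _ _ _ _ _ _ _ h0 h1 hτ C1 C2 (hδ0 j) (c10 j) hkα

lemma mp_le {α β : Type*} [MeasurableSpace α] [MeasurableSpace β] {μ : Measure α} {ν : Measure β}
    [IsFiniteMeasure ν] {f : α → β} (h : MeasurePreserving f μ ν) (s : Set β) :
    μ.real (f ⁻¹' s) ≤ ν.real s := by
  have := Measure.le_map_apply (μ := μ) h.measurable.aemeasurable s
  rw [h.map_eq] at this
  exact ENNReal.toReal_mono (by finiteness) this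

lemma U_prob {ι κ : Type*} [Fintype ι] [DecidableEq ι] [Fintype κ] (i0 i1 : ι)
    (s : ℝ≥0) (hs : (Fintype.card κ : ℝ) * s = 1) (η τ : ℝ) (h0 : 0 < η) (h1 : η ≤ 1 / 100)
    (hτ : 0 < τ) (hT : Fintype.card ι * s = τ ^ 2)
    (a b : ι → ℝ) (hab : GD i0 i1 (Fintype.card ι * s) η a b)
    (A C : Set ((ι → ℝ) × (ι → ℝ))) (hA : MeasurableSet A)
    (hAC : ∀ p ∈ A, ∀ q : (ι → ℝ) × (ι → ℝ), (∀ j, |p.1 j - q.1 j| ≤ 60 * (η + τ * η ^ 2)) →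
      (∀ j, |p.2 j - q.2 j| ≤ 60 * (η + τ * η ^ 2)) → q ∈ C) :
    (Measure.pi fun _ : ι => gam s κ).real {U | (Sc U a, Sc U b) ∈ A} ≤
      8 * Real.exp (-(Fintype.card κ * η ^ 2 / 8)) +
      (((gam s ι).prod (gam s ι)).real {x | ((fun j => (Pi.single i0 1 : ι → ℝ) j + τ * x.1 j),
        (fun j => (Pi.single i1 1 : ι → ℝ) j + τ * x.2 j)) ∈ C} +
      2 * ((2 * Fintype.card ι + 4) * Real.exp (-(η ^ 2 / (2 * s))))) := by
  have hs0 : s ≠ 0 := by rintro rfl; simp at hs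
  obtain ⟨ga, gb, gaa, gbb, gab⟩ := hab
  rw [hT] at gaa gbb gab
  obtain ⟨e1, e2, α, k, β, hα, hβ, hατ, hkτ, hβτ, he1, he2, he12, hae, hbe⟩ :=
    gs a b τ η hτ h0 h1 gaa gbb gab
  have hmp := mp_resamp (κ := κ) s e1 e2 he1 he2 he12
  set E := {U : ι → κ → ℝ | (Sc U a, Sc U b) ∈ A} with hEdef
  have hE : MeasurableSet E := by
    have : Measurable (fun U : ι → κ → ℝ => (Sc U a, Sc U b)) := by
      refine Measurable.prodMk ?_ ?_ <;>
      · rw [measurable_pi_iff]; intro j; unfold Sc; fun_prop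
    exact this hA
  rw [← hmp.measureReal_preimage hE.nullMeasurableSet]
  refine fub _ _ _ (hmp.measurable hE) {p | PG η p.1 p.2} _ _ (pair_bad s hs η h0.le (by linarith))
    (by positivity) ?_
  rintro ⟨G, H⟩ hGH
  have hPG : PG η G H := hGH
  obtain ⟨g1, g2, g3⟩ := hGH
  obtain ⟨f1, f2, r1, r2, r3, -, -, hr1, hr2, hr3, hf1, hf2, hf12, hG, hH⟩ :=
    gs G H 1 η one_pos h0 h1 (by simpa using g1) (by simpa using g2) (by simpa using g3)
  simp only [mul_one] at hr1 hr2 hr3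
  have hpr := mp_proj2 (ι := ι) s f1 f2 hf1 hf2 hf12
  set C' := {x : (ι → ℝ) × (ι → ℝ) | ((fun j => (Pi.single i0 1 : ι → ℝ) j + τ * x.1 j),
        (fun j => (Pi.single i1 1 : ι → ℝ) j + τ * x.2 j)) ∈ C} with hC'
  set xg := {x : ι → ℝ | (∀ j, |x j| ≤ η) ∧ |∑ i, e1 i * x i| ≤ η ∧ |∑ i, e2 i * x i| ≤ η} with hxg
  have hb := x_bad s hs0 η h0.le e1 e2 he1 he2
  rw [← hxg] at hb
  have q1 : ((gam s ι).prod (gam s ι)).real (Prod.fst ⁻¹' xgᶜ) ≤ _ :=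
    (mp_le measurePreserving_fst _).trans hb
  have q2 : ((gam s ι).prod (gam s ι)).real (Prod.snd ⁻¹' xgᶜ) ≤ _ :=
    (mp_le measurePreserving_snd _).trans hb
  have hsingle : ∀ i j : ι, |(Pi.single i 1 : ι → ℝ) j| ≤ 1 := by
    intro i j; rw [Pi.single_apply]; split_ifs <;> simp
  have hsub : {U | (U, (G, H)) ∈ resamp e1 e2 ⁻¹' E} ⊆
      (fun V : ι → κ → ℝ => ((fun j => ∑ k, V j k * f1 k), (fun j => ∑ k, V j k * f2 k))) ⁻¹'
        (C' ∪ (Prod.fst ⁻¹' xgᶜ ∪ Prod.snd ⁻¹' xgᶜ)) := by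
    intro U hU
    rw [Set.mem_preimage]
    by_cases c1 : (fun j => ∑ k, U j k * f1 k) ∈ xg
    · by_cases c2 : (fun j => ∑ k, U j k * f2 k) ∈ xg
      · left
        have hd := U_det η τ h0 h1 hτ a b (Pi.single i0 1) (Pi.single i1 1) e1 e2 α k β hα hβ hατ hkτ
          hβτ he1 he2 he12 hae hbe ga gb (hsingle i0) (hsingle i1) G H f1 f2 r1 r2 r3 hr1 hr2 hr3 hG hH
          hPG U _ _ (fun _ => rfl) (fun _ => rfl) c1 c2
        exact hAC _ hU _ (fun j => (hd j).1) (fun j => (hd j).2)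
      · right; right; exact c2
    · right; left; exact c1
  calc _ ≤ _ := measureReal_mono hsub
    _ ≤ _ := mp_le hpr _
    _ ≤ _ := measureReal_union_le _ _
    _ ≤ _ := add_le_add le_rfl (measureReal_union_le _ _)
    _ ≤ _ := by linarith

lemma master {ι κ : Type*} [Fintype ι] [DecidableEq ι] [Fintype κ] (i0 i1 : ι) (hne : i0 ≠ i1)
    (s : ℝ≥0) (hs : (Fintype.card κ : ℝ) * s = 1) (ε τ : ℝ) (h0 : 0 < ε) (h1 : ε ≤ 1 / 1000)
    (hτ : 0 < τ) (hT : Fintype.card ι * s = τ ^ 2) (hT1 : 1 ≤ ε * τ ^ 2)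
    (hcard : Fintype.card κ ≤ Fintype.card ι) (δ : ℝ) (hδ : 3000 * (ε + τ * ε ^ 2) ≤ δ)
    (A C : Set ((ι → ℝ) × (ι → ℝ))) (hA : MeasurableSet A)
    (hAC : ∀ p ∈ A, ∀ q : (ι → ℝ) × (ι → ℝ), (∀ j, |p.1 j - q.1 j| ≤ δ) →
      (∀ j, |p.2 j - q.2 j| ≤ δ) → q ∈ C) :
    ((Measure.pi fun _ : ι => gam s κ).prod (Measure.pi fun _ : ι => gam s κ)).real
      {p | (Sc p.1 (fun j => ∑ l, p.2 j l * p.2 i0 l), Sc p.1 (fun j => ∑ l, p.2 j l * p.2 i1 l)) ∈ A} ≤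
      ((gam s ι).prod (gam s ι)).real {x | ((fun j => (Pi.single i0 1 : ι → ℝ) j + τ * x.1 j),
        (fun j => (Pi.single i1 1 : ι → ℝ) j + τ * x.2 j)) ∈ C} +
      44 * Fintype.card ι * Real.exp (-(Fintype.card κ * ε ^ 2 / 8)) := by
  have hs0 : s ≠ 0 := by rintro rfl; simp at hs
  have hs0' : (0:ℝ) < s := by positivity
  have hV := V_bad (ι := ι) i0 i1 hne s hs ε h0 (by linarith) (by rw [hT]; exact hT1) hcard
  have hE : MeasurableSet {p : (ι → κ → ℝ) × (ι → κ → ℝ) |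
      (Sc p.1 (fun j => ∑ l, p.2 j l * p.2 i0 l), Sc p.1 (fun j => ∑ l, p.2 j l * p.2 i1 l)) ∈ A} := by
    have : Measurable (fun p : (ι → κ → ℝ) × (ι → κ → ℝ) =>
      (Sc p.1 (fun j => ∑ l, p.2 j l * p.2 i0 l), Sc p.1 (fun j => ∑ l, p.2 j l * p.2 i1 l))) := by
      refine Measurable.prodMk ?_ ?_ <;>
      · rw [measurable_pi_iff]; intro j; unfold Sc; fun_prop
    exact this hA
  have key := fub _ _ _ hE _ _ _ hV (by positivity) (fun V hV' => U_prob i0 i1 s hs (6 * ε) τ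
    (by positivity) (by linarith) hτ hT _ _ hV' A C hA (by
      intro p hp q hq1 hq2
      have : 60 * (6 * ε + τ * (6 * ε) ^ 2) ≤ δ := by
        refine le_trans ?_ hδ
        have : 0 < τ * ε ^ 2 := by positivity
        linarith
      exact hAC p hp q (fun j => (hq1 j).trans this) (fun j => (hq2 j).trans this)))
  refine key.trans ?_
  have hN1 : (1:ℝ) ≤ Fintype.card ι := by
    have : 0 < Fintype.card ι := Fintype.card_pos_iff.2 ⟨i0⟩
    exact Nat.one_le_cast.2 this
  set N : ℝ := ((Fintype.card ι : ℕ) : ℝ)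
  set D : ℝ := ((Fintype.card κ : ℕ) : ℝ)
  have hD0 : 0 ≤ D := Nat.cast_nonneg _
  have e1 : Real.exp (-((6 * ε) ^ 2 / (2 * s))) ≤ Real.exp (-(D * ε ^ 2 / 8)) := by
    apply Real.exp_le_exp.2
    have : D = 1 / s := by field_simp; linarith
    rw [this]
    apply neg_le_neg
    rw [one_div_mul_eq_div, div_div, div_le_div_iff₀ (by positivity) (by positivity)]
    nlinarith [mul_pos (pow_pos h0 2) hs0']
  have e2 : Real.exp (-(D * (6 * ε) ^ 2 / 8)) ≤ Real.exp (-(D * ε ^ 2 / 8)) := by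
    apply Real.exp_le_exp.2
    gcongr
    linarith
  set X := Real.exp (-(D * ε ^ 2 / 8)) with hX
  have hX0 : 0 < X := Real.exp_pos _
  have e3 := mul_le_mul_of_nonneg_left e1 (show 0 ≤ 2 * (2 * N + 4) by positivity)
  have e4 := mul_le_mul_of_nonneg_right hN1 hX0.le
  linarith

lemma beat_affine {ι : Type*} [DecidableEq ι] (i : ι) (θ τ : ℝ) (hτ : 0 < τ) (x : ι → ℝ) :
    (fun j => (Pi.single i 1 : ι → ℝ) j + τ * x j) ∈ beat i θ ↔ x ∈ beat i ((1 + θ) / τ) := by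
  simp only [beat, Set.mem_ofPred_eq, Pi.single_eq_same]
  refine exists_congr fun j => and_congr_right fun hj => ?_
  rw [Pi.single_eq_of_ne hj, zero_add, add_comm (x i), ← le_sub_iff_add_le (b := x i), div_le_iff₀ hτ]
  constructor <;> intro h <;> linarith

lemma beat_near {ι : Type*} (i : ι) (θ δ : ℝ) (p q : ι → ℝ) (hp : p ∈ beat i θ)
    (h : ∀ j, |p j - q j| ≤ δ) : q ∈ beat i (θ - 2 * δ) := by
  obtain ⟨j, hj, hpj⟩ := hp
  refine ⟨j, hj, ?_⟩
  have h1 := abs_le.1 (h i)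
  have h2 := abs_le.1 (h j)
  linarith

lemma master2 {ι κ : Type*} [Fintype ι] [DecidableEq ι] [Fintype κ] (i0 i1 : ι) (hne : i0 ≠ i1)
    (s : ℝ≥0) (hs : (Fintype.card κ : ℝ) * s = 1) (ε τ : ℝ) (h0 : 0 < ε) (h1 : ε ≤ 1 / 1000)
    (hτ : 0 < τ) (hT : Fintype.card ι * s = τ ^ 2) (hT1 : 1 ≤ ε * τ ^ 2)
    (hcard : Fintype.card κ ≤ Fintype.card ι) (δ : ℝ) (hδ : 3000 * (ε + τ * ε ^ 2) ≤ δ)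
    (F : ℝ → Set ((ι → ℝ) × (ι → ℝ))) (hF : ∀ θ, MeasurableSet (F θ))
    (hnear : ∀ θ, ∀ p ∈ F θ, ∀ q : (ι → ℝ) × (ι → ℝ), (∀ j, |p.1 j - q.1 j| ≤ δ) →
      (∀ j, |p.2 j - q.2 j| ≤ δ) → q ∈ F (θ - 2 * δ))
    (M : Measure ((ι → κ → ℝ) × (ι → κ → ℝ)))
    (hM : M = (Measure.pi fun _ : ι => gam s κ).prod (Measure.pi fun _ : ι => gam s κ))
    (E : Set ((ι → κ → ℝ) × (ι → κ → ℝ)))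
    (hE : E = {p | (Sc p.1 (fun j => ∑ l, p.2 j l * p.2 i0 l),
      Sc p.1 (fun j => ∑ l, p.2 j l * p.2 i1 l)) ∈ F 0}) (Q : ℝ → ℝ)
    (hQ : ∀ θ, Q ((1 + θ) / τ) = ((gam s ι).prod (gam s ι)).real
      {x | ((fun j => (Pi.single i0 1 : ι → ℝ) j + τ * x.1 j),
        (fun j => (Pi.single i1 1 : ι → ℝ) j + τ * x.2 j)) ∈ F θ}) :
    M.real E ≤ Q ((1 - 2 * δ) / τ) + 44 * Fintype.card ι * Real.exp (-(Fintype.card κ * ε ^ 2 / 8)) ∧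
    Q ((1 + 2 * δ) / τ) - 44 * Fintype.card ι * Real.exp (-(Fintype.card κ * ε ^ 2 / 8)) ≤ M.real E := by
  subst hM
  have hm : Measurable (fun p : (ι → κ → ℝ) × (ι → κ → ℝ) =>
      (Sc p.1 (fun j => ∑ l, p.2 j l * p.2 i0 l), Sc p.1 (fun j => ∑ l, p.2 j l * p.2 i1 l))) := by
    refine Measurable.prodMk ?_ ?_ <;>
    · rw [measurable_pi_iff]; intro j; unfold Sc; fun_prop
  have hm2 : Measurable (fun x : (ι → ℝ) × (ι → ℝ) => 
      ((fun j => (Pi.single i0 1 : ι → ℝ) j + τ * x.1 j),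
        (fun j => (Pi.single i1 1 : ι → ℝ) j + τ * x.2 j))) := by
    fun_prop
  constructor
  · have := master i0 i1 hne s hs ε τ h0 h1 hτ hT hT1 hcard δ hδ (F 0) (F (0 - 2 * δ)) (hF 0) (hnear 0)
    rw [hE, sub_eq_add_neg 1, ← zero_sub, hQ]
    exact this
  · have := master i0 i1 hne s hs ε τ h0 h1 hτ hT hT1 hcard δ hδ (F 0)ᶜ (F (2 * δ))ᶜ (hF 0).compl (by
      intro p hp q h1 h2 hq
      apply hp
      have := hnear (2 * δ) q hq p (fun j => by rw [abs_sub_comm]; exact h1 j)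
        (fun j => by rw [abs_sub_comm]; exact h2 j)
      rwa [sub_self] at this)
    rw [hE, hQ]
    have e1 := probReal_compl_eq_one_sub (μ := (Measure.pi fun _ : ι => gam s κ).prod
      (Measure.pi fun _ : ι => gam s κ)) (hm (hF 0))
    have e2 := probReal_compl_eq_one_sub (μ := (gam s ι).prod (gam s ι)) (hm2 (hF (2 * δ)))
    rw [← Set.preimage_compl] at e1 e2
    change ((Measure.pi fun _ : ι => gam s κ).prod
      (Measure.pi fun _ : ι => gam s κ)).real (_ ⁻¹' _) ≤ ((gam s ι).prod (gam s ι)).real (_ ⁻¹' _) + _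
      at this
    change ((gam s ι).prod (gam s ι)).real (_ ⁻¹' _) - _ ≤ ((Measure.pi fun _ : ι => gam s κ).prod
      (Measure.pi fun _ : ι => gam s κ)).real (_ ⁻¹' _)
    rw [e1, e2] at this
    linarith

lemma score_eq {d n : ℕ} (u v : Fin n → Fin d → ℝ) (j i : Fin n) :
    scoreX u v j i = Sc u (fun k => ∑ l, v k l * v i l) j := by
  rw [Sc_eq]
  simp only [scoreX, Wcross, dotProduct, mulVec, Matrix.of_apply]
  refine Finset.sum_congr rfl fun p _ => ?_
  congr 1
  simp_rw [Finset.sum_mul]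
  rw [Finset.sum_comm]
  exact Finset.sum_congr rfl fun _ _ => Finset.sum_congr rfl fun _ _ => by ring

lemma failSet_eq {d n : ℕ} (i : Fin n) :
    failSet d n i = {p | Sc p.1 (fun j => ∑ l, p.2 j l * p.2 i l) ∈ beat i 0} := by
  ext p
  simp only [failSet, beat, Set.mem_ofPred_eq, score_eq, add_zero]
  constructor
  · rintro ⟨i', j, hi, hj, h⟩
    obtain rfl := Fin.ext hi
    exact ⟨j, hj, h⟩
  · rintro ⟨j, hj, h⟩
    exact ⟨i, j, rfl, hj, h⟩

lemma sandwich (d n : ℕ) (hd : 0 < d) (hn : 2 ≤ n) (hdn : d ≤ n) (ε τ δ L : ℝ) (h0 : 0 < ε)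
    (h1 : ε ≤ 1 / 1000) (hτ : 0 < τ) (hT : (n : ℝ) / d = τ ^ 2) (hT1 : 1 ≤ ε * τ ^ 2)
    (hδ : 3000 * (ε + τ * ε ^ 2) ≤ δ) (hL : 4 * δ / τ ≤ L) :
    ∃ q : ℝ × ℝ, 0 ≤ q.1 ∧ 0 ≤ q.2 ∧
      q.2 ≤ Real.exp (4 * δ / τ * L * d) * q.1 + Real.exp (-((L - 4 * δ / τ) ^ 2 * d / 2)) ∧
      (∀ i < 2, (gaussianModel d n (failSet d n i)).toReal ≤
        q.2 + 44 * n * Real.exp (-(d * ε ^ 2 / 8)) ∧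
        q.1 - 44 * n * Real.exp (-(d * ε ^ 2 / 8)) ≤ (gaussianModel d n (failSet d n i)).toReal) ∧
      (gaussianModel d n (failSet d n 0 ∩ failSet d n 1)).toReal ≤
        q.2 ^ 2 + 44 * n * Real.exp (-(d * ε ^ 2 / 8)) ∧
      q.1 ^ 2 - 44 * n * Real.exp (-(d * ε ^ 2 / 8)) ≤
        (gaussianModel d n (failSet d n 0 ∩ failSet d n 1)).toReal := by
  set s : ℝ≥0 := (d : ℝ≥0)⁻¹ with hsdef
  have hd' : (0:ℝ) < d := by exact_mod_cast hd
  have hsr : (s : ℝ) = (d : ℝ)⁻¹ := by simp [hsdef]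
  have hs : (Fintype.card (Fin d) : ℝ) * s = 1 := by
    rw [hsr, Fintype.card_fin]; field_simp
  have hs0 : s ≠ 0 := by rintro h; rw [h] at hs; simp at hs
  set i0 : Fin n := ⟨0, by omega⟩
  set i1 : Fin n := ⟨1, by omega⟩
  have hne : i0 ≠ i1 := by simp [i0, i1]
  have hT' : (Fintype.card (Fin n) : ℝ) * s = τ ^ 2 := by
    rw [hsr, Fintype.card_fin, ← hT]; rfl
  have hcard : Fintype.card (Fin d) ≤ Fintype.card (Fin n) := by simpa using hdn
  have hM : gaussianModel d n = (Measure.pi fun _ : Fin n => gam s (Fin d)).prod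
    (Measure.pi fun _ : Fin n => gam s (Fin d)) := rfl
  set Q : ℝ → ℝ := fun θ => (gam s (Fin n)).real (beat i0 θ) with hQ
  have ms := master2 i0 i1 hne s hs ε τ h0 h1 hτ hT' hT1 hcard δ hδ
  -- first column
  have k0 := ms (fun θ => {p | p.1 ∈ beat i0 θ}) (fun θ => measurable_fst (measurable_beat i0 θ))
    (fun θ p hp q h1 h2 => beat_near i0 θ δ _ _ hp h1) _ hM (failSet d n 0)
    (failSet_eq i0) Q (by
      intro θ
      simp only [Set.mem_ofPred_eq, beat_affine _ _ _ hτ]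
      exact ((measurePreserving_fst (μ := gam s (Fin n)) (ν := gam s (Fin n))).measureReal_preimage
        (measurable_beat i0 _).nullMeasurableSet).symm)
  have k1 := ms (fun θ => {p | p.2 ∈ beat i1 θ}) (fun θ => measurable_snd (measurable_beat i1 θ))
    (fun θ p hp q h1 h2 => beat_near i1 θ δ _ _ hp h2) _ hM (failSet d n 1)
    (failSet_eq i1) Q (by
      intro θ
      simp only [Set.mem_ofPred_eq, beat_affine _ _ _ hτ, hQ]
      rw [beat_swap s i0 i1]
      exact ((measurePreserving_snd (μ := gam s (Fin n)) (ν := gam s (Fin n))).measureReal_preimage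
        (measurable_beat i1 _).nullMeasurableSet).symm)
  have k2 := ms (fun θ => {p | p.1 ∈ beat i0 θ ∧ p.2 ∈ beat i1 θ})
    (fun θ => (measurable_fst (measurable_beat i0 θ)).inter (measurable_snd (measurable_beat i1 θ)))
    (fun θ p hp q h1 h2 => ⟨beat_near i0 θ δ _ _ hp.1 h1, beat_near i1 θ δ _ _ hp.2 h2⟩) _ hM
    (failSet d n 0 ∩ failSet d n 1)
    (by rw [show failSet d n 0 = _ from failSet_eq i0, show failSet d n 1 = _ from failSet_eq i1]; rfl)
    (fun θ => Q θ ^ 2) (by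
      intro θ
      simp only [Set.mem_ofPred_eq, beat_affine _ _ _ hτ]
      have := measureReal_prod_prod (μ := gam s (Fin n)) (ν := gam s (Fin n)) (beat i0 ((1 + θ) / τ))
        (beat i1 ((1 + θ) / τ))
      rw [← beat_swap s i0 i1, ← sq] at this
      exact this.symm)
  simp only [Fintype.card_fin] at k0 k1 k2
  have hδ0 : 0 ≤ δ := le_trans (by positivity) hδ
  have sh := shift_beat s hs0 i0 ((1 - 2 * δ) / τ) (4 * δ / τ) L (by positivity)
  have gl := gauss_lower s hs0 (L - 4 * δ / τ) (by linarith)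
  rw [neg_sub] at gl
  refine ⟨(Q ((1 + 2 * δ) / τ), Q ((1 - 2 * δ) / τ)), measureReal_nonneg, measureReal_nonneg, ?_, ?_,
    k2.1, k2.2⟩
  · have e1 : (1 - 2 * δ) / τ + 4 * δ / τ = (1 + 2 * δ) / τ := by ring
    have e2 : 4 * δ / τ * L / s = 4 * δ / τ * L * d := by rw [hsr]; field_simp
    have e3 : (L - 4 * δ / τ) ^ 2 / (2 * s) = (L - 4 * δ / τ) ^ 2 * d / 2 := by rw [hsr]; field_simp
    rw [e1, e2] at sh
    rw [e3] at gl
    exact sh.trans (by linarith)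
  · intro i hi
    interval_cases i
    · exact k0
    · exact k1

lemma pt (d n : ℕ) (y : ℝ) (hy : 100 ≤ y) (hdy : (d : ℝ) = y ^ 20) (hn1 : (n : ℝ) ≤ y ^ 40)
    (hn2 : y ^ 38 ≤ n) :
    ∃ q : ℝ × ℝ, 0 ≤ q.1 ∧ 0 ≤ q.2 ∧
      q.2 ≤ Real.exp (24000 * y⁻¹ ^ 3) * q.1 + 44 * y ^ 40 * Real.exp (-(y ^ 4 / 8)) ∧
      (∀ i < 2, (gaussianModel d n (failSet d n i)).toReal ≤
        q.2 + 44 * y ^ 40 * Real.exp (-(y ^ 4 / 8)) ∧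
        q.1 - 44 * y ^ 40 * Real.exp (-(y ^ 4 / 8)) ≤ (gaussianModel d n (failSet d n i)).toReal) ∧
      (gaussianModel d n (failSet d n 0 ∩ failSet d n 1)).toReal ≤
        q.2 ^ 2 + 44 * y ^ 40 * Real.exp (-(y ^ 4 / 8)) ∧
      q.1 ^ 2 - 44 * y ^ 40 * Real.exp (-(y ^ 4 / 8)) ≤
        (gaussianModel d n (failSet d n 0 ∩ failSet d n 1)).toReal := by
  have hy0 : 0 < y := by linarith
  have hy1 : 1 ≤ y := by linarith
  have hpow : ∀ a b : ℕ, a ≤ b → y ^ a ≤ y ^ b := fun a b h => pow_le_pow_right₀ hy1 h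
  have hd0 : (0:ℝ) < d := by rw [hdy]; positivity
  have hn0 : (0:ℝ) < n := lt_of_lt_of_le (by positivity) hn2
  set τ : ℝ := √((n : ℝ) / d)
  have hτ2 : τ ^ 2 = n / d := Real.sq_sqrt (by positivity)
  have hτ0 : 0 < τ := Real.sqrt_pos.2 (by positivity)
  have hτlow : y ^ 9 ≤ τ := by
    apply Real.le_sqrt_of_sq_le
    rw [hdy, le_div_iff₀ (by positivity)]
    calc _ = y ^ 38 := by ring
      _ ≤ _ := hn2
  have hτup : τ ≤ y ^ 10 := by
    apply Real.sqrt_le_iff.2 ⟨by positivity, ?_⟩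
    rw [hdy, div_le_iff₀ (by positivity)]
    calc _ ≤ _ := hn1
      _ = _ := by ring
  have hi0 : 0 < y⁻¹ := by positivity
  have hi1 : y⁻¹ ≤ 1 / 100 := by
    rw [inv_le_comm₀ hy0 (by norm_num)]; norm_num; exact hy
  have hyi : y * y⁻¹ = 1 := mul_inv_cancel₀ hy0.ne'
  have hi7 : y⁻¹ ^ 7 ≤ (1/100) ^ 7 := by gcongr
  have hτi : τ⁻¹ ≤ y⁻¹ ^ 9 := by
    rw [inv_pow]; exact inv_anti₀ (by positivity) hτlow
  have hh : 4 * (6000 * y⁻¹ ^ 6) / τ ≤ 24000 * y⁻¹ ^ 15 := by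
    rw [div_eq_mul_inv]
    calc _ ≤ 4 * (6000 * y⁻¹ ^ 6) * y⁻¹ ^ 9 := by gcongr
      _ = _ := by ring
  have hhL : 24000 * y⁻¹ ^ 15 ≤ y⁻¹ ^ 8 / 2 := by
    have := mul_le_mul_of_nonneg_right hi7 (show 0 ≤ y⁻¹ ^ 8 by positivity)
    have e : y⁻¹ ^ 15 = y⁻¹ ^ 7 * y⁻¹ ^ 8 := by ring
    rw [e]
    nlinarith [pow_pos hi0 8]
  obtain ⟨q, q1, q2, q3, q4, q5, q6⟩ := sandwich d n (by exact_mod_cast hd0)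
    (by
      have : (2:ℝ) ≤ n := by
        refine le_trans ?_ hn2
        have := hpow 1 38 (by norm_num)
        linarith
      exact_mod_cast this)
    (by
      have : (d:ℝ) ≤ n := by
        rw [hdy]; exact (hpow 20 38 (by norm_num)).trans hn2
      exact_mod_cast this) (y⁻¹ ^ 8) τ (6000 * y⁻¹ ^ 6) (y⁻¹ ^ 8) (by positivity)
    (by
      have : y⁻¹ ^ 8 ≤ (1/100) ^ 8 := by gcongr
      refine this.trans (by norm_num)) hτ0 hτ2.symm
    (by
      calc (1:ℝ) = (y * y⁻¹) ^ 8 := by rw [hyi]; simp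
        _ = y⁻¹ ^ 8 * y ^ 8 := by ring
        _ ≤ y⁻¹ ^ 8 * τ ^ 2 := by
          gcongr
          calc _ ≤ y ^ 18 := hpow _ _ (by norm_num)
            _ = (y ^ 9) ^ 2 := by ring
            _ ≤ _ := by gcongr)
    (by
      have e1 : τ * (y⁻¹ ^ 8) ^ 2 ≤ y⁻¹ ^ 6 := by
        calc _ ≤ y ^ 10 * (y⁻¹ ^ 8) ^ 2 := by gcongr
          _ = (y * y⁻¹) ^ 10 * y⁻¹ ^ 6 := by ring
          _ = _ := by rw [hyi]; simp
      have e2 : y⁻¹ ^ 8 ≤ y⁻¹ ^ 6 := pow_le_pow_of_le_one hi0.le (by linarith) (by norm_num)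
      linarith)
    (by
      have := pow_pos hi0 8
      linarith)
  set h := 4 * (6000 * y⁻¹ ^ 6) / τ
  have hh0 : 0 < h := by positivity
  have hB : 44 * n * Real.exp (-(d * (y⁻¹ ^ 8) ^ 2 / 8)) ≤ 44 * y ^ 40 * Real.exp (-(y ^ 4 / 8)) := by
    have : (d:ℝ) * (y⁻¹ ^ 8) ^ 2 = y ^ 4 := by
      rw [hdy]
      calc _ = (y * y⁻¹) ^ 16 * y ^ 4 := by ring
        _ = _ := by rw [hyi]; simp
    rw [this]
    gcongr
  have hB' : Real.exp (-((y⁻¹ ^ 8 - h) ^ 2 * d / 2)) ≤ 44 * y ^ 40 * Real.exp (-(y ^ 4 / 8)) := by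
    have e : y ^ 4 / 8 ≤ (y⁻¹ ^ 8 - h) ^ 2 * d / 2 := by
      have : y⁻¹ ^ 8 / 2 ≤ y⁻¹ ^ 8 - h := by linarith
      calc _ = (y * y⁻¹) ^ 16 * y ^ 4 / 8 := by rw [hyi]; simp
        _ = (y⁻¹ ^ 8 / 2) ^ 2 * y ^ 20 / 2 := by ring
        _ ≤ _ := by rw [hdy]; gcongr
    calc _ ≤ Real.exp (-(y ^ 4 / 8)) := Real.exp_le_exp.2 (by linarith)
      _ ≤ _ := by
        apply le_mul_of_one_le_left (Real.exp_pos _).le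
        have := one_le_pow₀ (n := 40) hy1
        linarith
  have hK : Real.exp (h * y⁻¹ ^ 8 * d) ≤ Real.exp (24000 * y⁻¹ ^ 3) := by
    apply Real.exp_le_exp.2
    rw [hdy]
    calc _ ≤ 24000 * y⁻¹ ^ 15 * y⁻¹ ^ 8 * y ^ 20 := by gcongr
      _ = 24000 * y⁻¹ ^ 3 * (y * y⁻¹) ^ 20 := by ring
      _ = _ := by rw [hyi]; simp
  refine ⟨q, q1, q2, ?_, ?_, by linarith, by linarith⟩
  · have := mul_le_mul_of_nonneg_right hK q1
    linarith
  · intro i hi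
    have := q4 i hi
    constructor <;> linarith [this.1, this.2]

lemma asym (P P1 J ζ k : ℕ → ℝ) (q : ℕ → ℝ × ℝ) (hζ : Tendsto ζ atTop (𝓝 0))
    (hk : Tendsto k atTop (𝓝 0))
    (h : ∀ᶠ m in atTop, ∃ Z, 0 < P m ∧ P m ≤ 1 ∧ 0 ≤ Z ∧ Z ≤ ζ m * P m ^ 2 ∧
      0 ≤ (q m).1 ∧ 0 ≤ (q m).2 ∧
      (q m).2 ≤ Real.exp (k m) * (q m).1 + Z ∧ P m ≤ (q m).2 + Z ∧ (q m).1 - Z ≤ P m ∧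
      P1 m ≤ (q m).2 + Z ∧ (q m).1 - Z ≤ P1 m ∧ J m ≤ (q m).2 ^ 2 + Z ∧ (q m).1 ^ 2 - Z ≤ J m) :
    Tendsto (fun m => J m / (P m * P1 m)) atTop (𝓝 1) := by
  have hE : Tendsto (fun m => Real.exp (k m)) atTop (𝓝 1) := by
    have := (Real.continuous_exp.tendsto 0).comp hk
    rw [Real.exp_zero] at this
    exact this
  have h' : ∀ᶠ m in atTop, 0 < P m ∧ 0 ≤ (q m).1 / P m ∧ 0 ≤ (q m).2 / P m ∧
      (q m).2 / P m ≤ Real.exp (k m) * ((q m).1 / P m) + ζ m ∧ 1 - ζ m ≤ (q m).2 / P m ∧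
      (q m).1 / P m ≤ 1 + ζ m ∧ P1 m / P m ≤ (q m).2 / P m + ζ m ∧
      (q m).1 / P m - ζ m ≤ P1 m / P m ∧ J m / P m ^ 2 ≤ ((q m).2 / P m) ^ 2 + ζ m ∧
      ((q m).1 / P m) ^ 2 - ζ m ≤ J m / P m ^ 2 := by
    filter_upwards [h] with m ⟨Z, h1, h2, h3, h4, h5, h6, h7, h8, h9, h10, h11, h12, h13⟩
    have hζ0 : 0 ≤ ζ m := by
      by_contra hc
      push Not at hc
      nlinarith [pow_pos h1 2]
    have hZ : Z ≤ ζ m * P m := by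
      refine h4.trans ?_
      apply mul_le_mul_of_nonneg_left _ hζ0
      nlinarith
    have hP2 : 0 < P m ^ 2 := by positivity
    refine ⟨h1, by positivity, by positivity, ?_, ?_, ?_, ?_, ?_, ?_, ?_⟩
    · rw [← mul_div_assoc, div_add' _ _ _ h1.ne']; gcongr; linarith
    · rw [le_div_iff₀ h1]; linarith
    · rw [div_le_iff₀ h1]; linarith
    · rw [div_add' _ _ _ h1.ne']; gcongr; linarith
    · rw [div_sub' h1.ne']; gcongr; linarith
    · rw [div_pow, div_add' _ _ _ hP2.ne']; gcongr; linarith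
    · rw [div_pow, div_sub' hP2.ne']; gcongr; linarith
  have hqm : Tendsto (fun m => (q m).1 / P m) atTop (𝓝 1) := by
    have lo : Tendsto (fun m => (1 - 2 * ζ m) / Real.exp (k m)) atTop (𝓝 1) := by
      have := (((hζ.const_mul 2).const_sub 1)).div hE one_ne_zero
      simp only [mul_zero, sub_zero, div_one] at this
      exact this
    have up : Tendsto (fun m => 1 + ζ m) atTop (𝓝 1) := by simpa using hζ.const_add 1
    refine tendsto_of_tendsto_of_tendsto_of_le_of_le' lo up ?_ ?_
    · filter_upwards [h'] with m hm
      obtain ⟨a1, a2, a3, a4, a5, -⟩ := hm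
      rw [div_le_iff₀ (Real.exp_pos _)]
      linarith
    · filter_upwards [h'] with m hm
      exact hm.2.2.2.2.2.1
  have hqp : Tendsto (fun m => (q m).2 / P m) atTop (𝓝 1) := by
    have lo : Tendsto (fun m => 1 - ζ m) atTop (𝓝 1) := by simpa using hζ.const_sub 1
    have up : Tendsto (fun m => Real.exp (k m) * ((q m).1 / P m) + ζ m) atTop (𝓝 1) := by
      simpa using (hE.mul hqm).add hζ
    refine tendsto_of_tendsto_of_tendsto_of_le_of_le' lo up ?_ ?_
    · filter_upwards [h'] with m hm
      exact hm.2.2.2.2.1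
    · filter_upwards [h'] with m hm
      exact hm.2.2.2.1
  have hp1 : Tendsto (fun m => P1 m / P m) atTop (𝓝 1) := by
    have lo : Tendsto (fun m => (q m).1 / P m - ζ m) atTop (𝓝 1) := by simpa using hqm.sub hζ
    have up : Tendsto (fun m => (q m).2 / P m + ζ m) atTop (𝓝 1) := by simpa using hqp.add hζ
    refine tendsto_of_tendsto_of_tendsto_of_le_of_le' lo up ?_ ?_
    · filter_upwards [h'] with m hm
      exact hm.2.2.2.2.2.2.2.1
    · filter_upwards [h'] with m hm
      exact hm.2.2.2.2.2.2.1
  have hJ : Tendsto (fun m => J m / P m ^ 2) atTop (𝓝 1) := by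
    have lo : Tendsto (fun m => ((q m).1 / P m) ^ 2 - ζ m) atTop (𝓝 1) := by
      simpa using (hqm.pow 2).sub hζ
    have up : Tendsto (fun m => ((q m).2 / P m) ^ 2 + ζ m) atTop (𝓝 1) := by
      simpa using (hqp.pow 2).add hζ
    refine tendsto_of_tendsto_of_tendsto_of_le_of_le' lo up ?_ ?_
    · filter_upwards [h'] with m hm
      exact hm.2.2.2.2.2.2.2.2.2
    · filter_upwards [h'] with m hm
      exact hm.2.2.2.2.2.2.2.2.1
  have := hJ.div hp1 one_ne_zero
  rw [div_one] at this
  refine this.congr' ?_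
  filter_upwards [h'] with m hm
  have hP := hm.1.ne'
  simp only [Pi.div_apply]
  rw [div_div_eq_mul_div, div_mul_eq_mul_div, div_div]
  by_cases h0 : P1 m = 0
  · simp [h0]
  · field_simp

/-- **Asymptotic independence of two failure events.** In the regime `d² ≍ n log n`,
if `n P(F_1) → ∞` then `P(F_1 ∩ F_2) = P(F_1) P(F_2) (1 + ω_n)` with `ω_n → 0`. -/
theorem failure_events_asymptotically_independent (n d : ℕ → ℕ)
    (hn : Tendsto n atTop atTop) (hd : Tendsto d atTop atTop)
    (cL cU : ℝ) (hcL : 0 < cL) (hcU : 0 < cU)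
    (hlow : ∀ m, cL * (n m * Real.log (n m)) ≤ (d m : ℝ) ^ 2)
    (hup : ∀ m, (d m : ℝ) ^ 2 ≤ cU * (n m * Real.log (n m)))
    (hdiv : Tendsto (fun m => (n m : ℝ) *
        (gaussianModel (d m) (n m) (failSet (d m) (n m) 0)).toReal) atTop atTop) :
    ∃ ω : ℕ → ℝ, Tendsto ω atTop (𝓝 0) ∧ ∀ m,
      (gaussianModel (d m) (n m)
          (failSet (d m) (n m) 0 ∩ failSet (d m) (n m) 1)).toReal =
        (gaussianModel (d m) (n m) (failSet (d m) (n m) 0)).toReal *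
          (gaussianModel (d m) (n m) (failSet (d m) (n m) 1)).toReal * (1 + ω m) := by
  have hprob : ∀ d n, IsProbabilityMeasure (gaussianModel d n) := by
    intro d n
    have : IsProbabilityMeasure (stdGaussianVec d) := by unfold stdGaussianVec; infer_instance
    unfold gaussianModel; infer_instance
  set P : ℕ → ℝ := fun m => (gaussianModel (d m) (n m) (failSet (d m) (n m) 0)).toReal with hP
  set P1 : ℕ → ℝ := fun m => (gaussianModel (d m) (n m) (failSet (d m) (n m) 1)).toReal with hP1
  set J : ℕ → ℝ := fun m => (gaussianModel (d m) (n m)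
    (failSet (d m) (n m) 0 ∩ failSet (d m) (n m) 1)).toReal with hJ
  have hJP : ∀ m, J m ≤ P m := fun m =>
    ENNReal.toReal_mono (measure_ne_top _ _) (measure_mono Set.inter_subset_left)
  have hJP1 : ∀ m, J m ≤ P1 m := fun m =>
    ENNReal.toReal_mono (measure_ne_top _ _) (measure_mono Set.inter_subset_right)
  have hJ0 : ∀ m, 0 ≤ J m := fun m => ENNReal.toReal_nonneg
  suffices hlim : Tendsto (fun m => J m / (P m * P1 m)) atTop (𝓝 1) by
    refine ⟨fun m => J m / (P m * P1 m) - 1, by simpa using hlim.sub_const 1, fun m => ?_⟩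
    change J m = P m * P1 m * (1 + (J m / (P m * P1 m) - 1))
    by_cases h : P m * P1 m = 0
    · rw [h, zero_mul]
      rcases mul_eq_zero.1 h with h | h
      · exact le_antisymm (h ▸ hJP m) (hJ0 m)
      · exact le_antisymm (h ▸ hJP1 m) (hJ0 m)
    · rw [add_sub_cancel, mul_div_cancel₀ _ h]
  have hD : Tendsto (fun m => (d m : ℝ)) atTop atTop := tendsto_natCast_atTop_atTop.comp hd
  have hN : Tendsto (fun m => (n m : ℝ)) atTop atTop := tendsto_natCast_atTop_atTop.comp hn
  set y : ℕ → ℝ := fun m => (d m : ℝ) ^ (1 / 20 : ℝ) with hydef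
  have hy : Tendsto y atTop atTop := (tendsto_rpow_atTop (by norm_num)).comp hD
  have hy20 : ∀ m, (d m : ℝ) = y m ^ 20 := by
    intro m
    rw [hydef, ← Real.rpow_natCast, ← Real.rpow_mul (Nat.cast_nonneg _)]
    norm_num
  have hlog : ∀ᶠ t : ℝ in atTop, cU * (40 * Real.log t) ≤ t ^ 2 := by
    have h1 := (isLittleO_log_rpow_atTop (r := 2) (by norm_num)).bound
      (show (0:ℝ) < 1 / (cU * 40) by positivity)
    filter_upwards [h1, eventually_ge_atTop 1] with t ht ht1
    rw [Real.norm_of_nonneg (Real.log_nonneg ht1), Real.norm_of_nonneg (by positivity),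
      one_div_mul_eq_div, le_div_iff₀ (by positivity), Real.rpow_two] at ht
    linarith
  have hev : ∀ᶠ m in atTop, 100 ≤ y m ∧ (n m : ℝ) ≤ y m ^ 40 ∧ y m ^ 38 ≤ n m ∧ 1 ≤ n m * P m := by
    filter_upwards [hy.eventually_ge_atTop 100, hy.eventually hlog,
      hN.eventually_ge_atTop 1, (Real.tendsto_log_atTop.comp hN).eventually_ge_atTop (1 / cL),
      hdiv.eventually_ge_atTop 1] with m m1 m2 m3 m4 m5
    have hdy : (d m : ℝ) ^ 2 = y m ^ 40 := by rw [hy20]; ring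
    have hy0 : 0 < y m := by linarith
    have hn0 : (0:ℝ) < n m := by linarith
    have a1 : (n m : ℝ) ≤ y m ^ 40 := by
      have h1 := hlow m
      rw [hdy] at h1
      refine le_trans ?_ h1
      have h2 : 1 ≤ cL * Real.log (n m) := by
        have := mul_le_mul_of_nonneg_left m4 hcL.le
        rwa [mul_one_div_cancel hcL.ne'] at this
      nlinarith
    refine ⟨m1, a1, ?_, m5⟩
    have h1 := hup m
    rw [hdy] at h1
    have h2 : Real.log (n m) ≤ 40 * Real.log (y m) := by
      have := Real.log_le_log hn0 a1
      rwa [Real.log_pow] at this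
    have h3 : cU * Real.log (n m) ≤ y m ^ 2 := (mul_le_mul_of_nonneg_left h2 hcU.le).trans m2
    have h4 : y m ^ 38 * y m ^ 2 ≤ n m * y m ^ 2 := by
      calc _ = y m ^ 40 := by ring
        _ ≤ _ := h1
        _ = n m * (cU * Real.log (n m)) := by ring
        _ ≤ _ := by gcongr
    exact le_of_mul_le_mul_right h4 (by positivity)
  obtain ⟨q, hq⟩ := (hev.mono fun m hm => pt (d m) (n m) (y m) hm.1 (hy20 m) hm.2.1 hm.2.2.1).choice
  refine asym P P1 J (fun m => 44 * y m ^ 120 * Real.exp (-(y m ^ 4 / 8)))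
    (fun m => 24000 * (y m)⁻¹ ^ 3) q ?_ ?_ ?_
  · have h1 : Tendsto (fun t : ℝ => t ^ 4 / 8) atTop atTop :=
      (tendsto_pow_atTop (by norm_num)).atTop_div_const (by norm_num)
    have h2 := ((Real.tendsto_pow_mul_exp_neg_atTop_nhds_zero 30).comp (h1.comp hy)).const_mul
      (44 * 8 ^ 30)
    rw [mul_zero] at h2
    refine h2.congr fun m => ?_
    simp only [Function.comp]
    rw [div_pow]
    ring
  · have := ((tendsto_inv_atTop_zero.comp hy).pow 3).const_mul 24000
    simpa using this
  · filter_upwards [hev, hq] with m ⟨e1, e2, e3, e4⟩ ⟨q1, q2, q3, q4, q5, q6⟩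
    have hy0 : 0 < y m := by linarith
    have hPm : 0 < P m := by
      by_contra hc
      push Not at hc
      have : (0:ℝ) ≤ n m := Nat.cast_nonneg _
      nlinarith
    have hPy : 1 ≤ y m ^ 40 * P m := e4.trans (by gcongr)
    refine ⟨44 * y m ^ 40 * Real.exp (-(y m ^ 4 / 8)), hPm, ?_, by positivity, ?_, q1, q2, q3,
      (q4 0 (by norm_num)).1, (q4 0 (by norm_num)).2, (q4 1 (by norm_num)).1,
      (q4 1 (by norm_num)).2, q5, q6⟩
    · exact measureReal_le_one
    · have h1 : 1 ≤ (y m ^ 40 * P m) ^ 2 := one_le_pow₀ hPy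
      calc _ ≤ 44 * y m ^ 40 * Real.exp (-(y m ^ 4 / 8)) * (y m ^ 40 * P m) ^ 2 :=
            le_mul_of_one_le_right (by positivity) h1
        _ = _ := by ring

end
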